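/- arXiv:1805.05411 — 2 statements merged into one kernel-verified Lean document; each statement's English description precedes it below -/
import Mathlib

section
/- (Theorem 4, linear convergence of RaDual.) Suppose the parameters are constant: α̃_t = α, α_t = (m−1)α, τ_t = α/(1−α), η_t = ((α − (m−2)/(m−1))μ)/(1−α) for all t, where α = 1 − 2/((m−1)(√(1+8c)+1)) and c = Ā²/(μμ̄) = L̂Ā²/μ. Then for every s ≥ 1: 𝔼[ ‖xˢ − x*‖² + ‖x_mˢ − x_m*‖² ] ≤ αˢ·(2L̂/μ)·( ‖x⁰ − x*‖² + ‖x_m⁰ − x_m*‖² ), where x_m* = argmin_{w∈ℝⁿ}{ψ_m(w) + ⟨w, y*⟩}. -/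
open RealInnerProductSpace Finset

/-- Bregman divergence associated with a differentiable function `h`. -/
noncomputable def breg {n : ℕ} (h : EuclideanSpace ℝ (Fin n) → ℝ)
    (x y : EuclideanSpace ℝ (Fin n)) : ℝ :=
  h x - h y - ⟪gradient h y, x - y⟫


/-- Variational inequality for a proximal minimizer over a convex set. -/
lemma vi_of_min {E : Type*} [NormedAddCommGroup E] [InnerProductSpace ℝ E] [CompleteSpace E]
    (f : E → ℝ) (hf : Differentiable ℝ f) (S : Set E) (hS : Convex ℝ S) (v x' x : E) (η : ℝ)
    (hx : x ∈ S)
    (hmin : ∀ z ∈ S, f x + ⟪v, x⟫ + η / 2 * ‖x - x'‖ ^ 2 ≤ f z + ⟪v, z⟫ + η / 2 * ‖z - x'‖ ^ 2) :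
    ∀ z ∈ S, 0 ≤ ⟪gradient f x, z - x⟫ + ⟪v, z - x⟫ + η * ⟪x - x', z - x⟫ := by
  intro z hz
  have h1 : HasFDerivAt f (fderiv ℝ f x) x := (hf x).hasFDerivAt
  have h2 : HasFDerivAt (fun z : E => ⟪v, z⟫) (innerSL ℝ v) x := (innerSL ℝ v).hasFDerivAt
  have h3 : HasFDerivAt (fun z : E => ‖z - x'‖ ^ 2) (2 • (innerSL ℝ (x - x'))) x := by
    have := ((hasFDerivAt_id x).sub_const x').norm_sq
    simpa using this
  have h4 := (h1.add h2).add (h3.const_mul (η / 2))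
  have hloc : IsLocalMinOn (fun z => f z + ⟪v, z⟫ + η / 2 * ‖z - x'‖ ^ 2) S x := by
    apply IsMinOn.localize
    intro w hw
    exact hmin w hw
  have h5 := hloc.hasFDerivWithinAt_nonneg (h4.hasFDerivWithinAt (s := S))
    (sub_mem_posTangentConeAt_of_segment_subset (hS.segment_subset hx hz))
  have hg : fderiv ℝ f x (z - x) = ⟪gradient f x, z - x⟫ := by
    simp [gradient]
  simp only [_root_.add_apply, _root_.smul_apply, innerSL_apply_apply,
    hg, nsmul_eq_mul, smul_eq_mul] at h5
  push_cast at h5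
  nlinarith [h5]

lemma prox_ineq {E : Type*} [NormedAddCommGroup E] [InnerProductSpace ℝ E] [CompleteSpace E]
    (f : E → ℝ) (hf : Differentiable ℝ f) (S : Set E) (hS : Convex ℝ S) (v x' x : E) (η μ : ℝ)
    (hx : x ∈ S)
    (hsc : ∀ z ∈ S, f z - f x - ⟪gradient f x, z - x⟫ ≥ μ / 2 * ‖z - x‖ ^ 2)
    (hmin : ∀ z ∈ S, f x + ⟪v, x⟫ + η / 2 * ‖x - x'‖ ^ 2 ≤ f z + ⟪v, z⟫ + η / 2 * ‖z - x'‖ ^ 2) :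
    ∀ z ∈ S, f x + ⟪v, x⟫ + η / 2 * ‖x - x'‖ ^ 2 + (μ + η) / 2 * ‖z - x‖ ^ 2
      ≤ f z + ⟪v, z⟫ + η / 2 * ‖z - x'‖ ^ 2 := by
  intro z hz
  have h1 := vi_of_min f hf S hS v x' x η hx hmin z hz
  have h2 := hsc z hz
  have h3 : ‖z - x'‖ ^ 2 = ‖z - x‖ ^ 2 + 2 * ⟪x - x', z - x⟫ + ‖x - x'‖ ^ 2 := by
    have : z - x' = (z - x) + (x - x') := by abel
    rw [this, norm_add_sq_real, real_inner_comm]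
  rw [inner_sub_right v] at h1
  rw [h3]
  nlinarith [h1, h2]

lemma sum_one_diff {ι M : Type*} [Fintype ι] [AddCommGroup M] (u v : ι → M) (j : ι)
    (huv : ∀ i, i ≠ j → u i = v i) : ∑ i, u i = ∑ i, v i - v j + u j := by
  have : ∑ i, (u i - v i) = u j - v j :=
    Fintype.sum_eq_single j (fun i hi => by rw [huv i hi, sub_self])
  rw [Finset.sum_sub_distrib] at this
  rw [sub_eq_iff_eq_add] at this
  rw [this]; abel

lemma young {K a b u v : ℝ} (hu : 0 ≤ u) (hv : 0 ≤ v)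
    (hK : K ^ 2 ≤ 4 * u * v) : K * a * b ≤ u * a ^ 2 + v * b ^ 2 := by
  refine abs_le_of_sq_le_sq' ?_ (by positivity) |>.2
  have h1 : K ^ 2 * (a ^ 2 * b ^ 2) ≤ 4 * u * v * (a ^ 2 * b ^ 2) :=
    mul_le_mul_of_nonneg_right hK (by positivity)
  nlinarith [sq_nonneg (u * a ^ 2 - v * b ^ 2), h1]

lemma sum_update_avg {s p : ℕ} (f : (Fin s → Fin p) → ℝ) (t : Fin s) :
    ∑ ω, ∑ j, f (Function.update ω t j) = p * ∑ ω, f ω := by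
  have hinv : Function.Involutive
      (fun q : (Fin s → Fin p) × Fin p => (Function.update q.1 t q.2, q.1 t)) := by
    rintro ⟨ω, j⟩
    simp
  have h1 := Equiv.sum_comp hinv.toPerm (fun q : (Fin s → Fin p) × Fin p => f q.1)
  rw [Fintype.sum_prod_type, Fintype.sum_prod_type] at h1
  simp only [Function.Involutive.coe_toPerm] at h1
  rw [h1]
  simp [Finset.mul_sum]

/-- Basic facts on the parameters. -/
lemma params {p c α τ η μ μb Ab : ℝ} (hp : 1 ≤ p) (hμ : 0 < μ) (hμb : 0 < μb)
    (hc : c = Ab ^ 2 / (μ * μb))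
    (hα : α = 1 - 2 / (p * (Real.sqrt (1 + 8 * c) + 1)))
    (hτ : τ = α / (1 - α)) (hη : η = (α - (p - 1) / p) * μ / (1 - α)) :
    0 < 1 - α ∧ 0 ≤ α ∧ 0 ≤ η ∧ 0 ≤ τ ∧ (1 - α) * τ = α ∧
      (1 - α) * η * p = (1 - p * (1 - α)) * μ ∧
      2 * (1 - α) ^ 2 * p ^ 2 * Ab ^ 2 = (1 - p * (1 - α)) * (μ * μb) := by
  have hc0 : 0 ≤ c := by rw [hc]; positivity
  have hAb : Ab ^ 2 = c * (μ * μb) := by rw [hc]; field_simp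
  obtain ⟨R, hR⟩ : ∃ R, R = Real.sqrt (1 + 8 * c) := ⟨_, rfl⟩
  have hR2 : R ^ 2 = 1 + 8 * c := by rw [hR]; exact Real.sq_sqrt (by linarith)
  have hR1 : 1 ≤ R := by rw [hR]; exact Real.one_le_sqrt.2 (by linarith)
  rw [← hR] at hα
  have hp0 : 0 < p := by linarith
  have he : 1 - α = 2 / (p * (R + 1)) := by rw [hα]; ring
  have hepos : 0 < 1 - α := by rw [he]; positivity
  have hpe : p * (1 - α) = 2 / (R + 1) := by rw [he]; field_simp
  have hpe1 : p * (1 - α) ≤ 1 := by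
    rw [hpe, div_le_one (by linarith)]; linarith
  have hα0 : 0 ≤ α := by nlinarith
  have hη' : (1 - α) * η * p = (1 - p * (1 - α)) * μ := by
    rw [hη]; field_simp; ring
  have hτ' : (1 - α) * τ = α := by rw [hτ]; field_simp
  refine ⟨hepos, hα0, ?_, ?_, hτ', hη', ?_⟩
  · rw [hη]
    apply div_nonneg _ hepos.le
    apply mul_nonneg _ hμ.le
    have : (α - (p - 1) / p) = (1 - p * (1 - α)) / p := by field_simp; ring
    rw [this]
    apply div_nonneg <;> linarith
  · rw [hτ]; positivity
  · have h1 : 2 * (1 - α) ^ 2 * p ^ 2 * Ab ^ 2 = 2 * (p * (1 - α)) ^ 2 * Ab ^ 2 := by ring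
    have hc' : c = (R ^ 2 - 1) / 8 := by linarith
    rw [h1, hpe, hAb, hc']
    have : R + 1 ≠ 0 := by positivity
    field_simp
    ring

lemma one_step_scalar {p α τ η μ X Xh D Vn Vo a q1 q2 dx cr W : ℝ}
    (hp : 1 ≤ p) (hμ : 0 < μ) (he : 0 < 1 - α) (hXh : 0 ≤ Xh)
    (hτ : (1 - α) * τ = α)
    (hη : (1 - α) * η * p = (1 - p * (1 - α)) * μ)
    (h1 : -cr + τ * W + (1 + τ) * Vn ≤ τ * Vo)
    (h2 : (cr + a - p * α * (q1 + q2)) + η / 2 * D + (2 * μ + η) / 2 * Xh ≤ η / 2 * X)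
    (h3 : p * α * q2 ≤ τ * W + α * η * p / 2 * dx) :
    μ / 2 * (p * X - X + Xh) + p * Vn + (1 - α) * p * a + (1 - α) * η * p / 2 * D
      ≤ p * (α * (μ / 2 * X + Vo + (1 - α) * p * q1 + (1 - α) * η * p / 2 * dx)) := by
  have h4 : -cr + (cr + a - p * α * (q1 + q2)) + η / 2 * D + (2 * μ + η) / 2 * Xh
      + (1 + τ) * Vn + p * α * q2 - α * η * p / 2 * dx - η / 2 * X - τ * Vo ≤ 0 := by linarith
  have h5 := mul_nonpos_of_nonneg_of_nonpos (mul_nonneg he.le (by linarith : 0 ≤ p)) h4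
  have h6 : 0 ≤ (1 - α) * p * (μ / 2 * Xh) := by positivity
  have e1 : (1 - α) * p * (η / 2 * D) = (1 - α) * η * p / 2 * D := by ring
  have e2 : (1 - α) * p * ((2 * μ + η) / 2 * Xh)
      = (1 - α) * p * μ * Xh + (1 - p * (1 - α)) * μ / 2 * Xh := by rw [← hη]; ring
  have e3 : (1 - α) * p * ((1 + τ) * Vn) = p * Vn := by
    linear_combination p * Vn * hτ
  have e4 : (1 - α) * p * (η / 2 * X) = (1 - p * (1 - α)) * μ / 2 * X := by rw [← hη]; ring
  have e5 : (1 - α) * p * (τ * Vo) = p * α * Vo := by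
    linear_combination p * Vo * hτ
  have e6 : (1 - α) * p * (α * η * p / 2 * dx) = p * (α * ((1 - α) * η * p / 2 * dx)) := by ring
  linarith

lemma dual_step {F : Type*} [NormedAddCommGroup F] [InnerProductSpace ℝ F] [CompleteSpace F]
    (h : F → ℝ) (hd : Differentiable ℝ h) (v y y' : F) (τ : ℝ)
    (hmin : ∀ z, h y + ⟪v, y⟫ + τ * (h y - h y' - ⟪gradient h y', y - y'⟫)
      ≤ h z + ⟪v, z⟫ + τ * (h z - h y' - ⟪gradient h y', z - y'⟫)) (z : F) :
    0 ≤ (1 + τ) * ⟪gradient h y, z - y⟫ + ⟪v, z - y⟫ - τ * ⟪gradient h y', z - y⟫ := by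
  have hg : gradient (fun y => (1 + τ) * h y) y = (1 + τ) • gradient h y := by
    unfold gradient
    rw [fderiv_const_mul (hd y)]
    simp
  have := vi_of_min (fun y => (1 + τ) * h y) (hd.const_mul _) Set.univ convex_univ
    (v - τ • gradient h y') y' y 0 (Set.mem_univ _) (by
      intro z _
      have := hmin z
      simp only [inner_sub_left, inner_sub_right, real_inner_smul_left] at this ⊢
      linarith) z (Set.mem_univ _)
  rw [hg, inner_sub_left, real_inner_smul_left, real_inner_smul_left] at this
  linarith

lemma block_ineq {E F : Type*} [NormedAddCommGroup E] [InnerProductSpace ℝ E] [CompleteSpace E]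
    [NormedAddCommGroup F] [InnerProductSpace ℝ F] [CompleteSpace F]
    (f : E → ℝ) (hf : Differentiable ℝ f) (S : Set E) (hS : Convex ℝ S) (A : E →L[ℝ] F)
    (y ys : F) (x xh xs : E) (η μ : ℝ) (hxh : xh ∈ S) (hxs : xs ∈ S)
    (hsc : ∀ z ∈ S, ∀ w ∈ S, f z - f w - ⟪gradient f w, z - w⟫ ≥ μ / 2 * ‖z - w‖ ^ 2)
    (hmin : ∀ z ∈ S, f xh + ⟪ContinuousLinearMap.adjoint A y, xh⟫ + η / 2 * ‖xh - x‖ ^ 2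
      ≤ f z + ⟪ContinuousLinearMap.adjoint A y, z⟫ + η / 2 * ‖z - x‖ ^ 2)
    (hmins : ∀ z ∈ S, f xs + ⟪A xs, ys⟫ ≤ f z + ⟪A z, ys⟫) :
    ⟪A xh - A xs, y - ys⟫ + η / 2 * ‖xh - x‖ ^ 2 + (2 * μ + η) / 2 * ‖xh - xs‖ ^ 2
      ≤ η / 2 * ‖x - xs‖ ^ 2 := by
  have h1 := prox_ineq f hf S hS _ x xh η μ hxh (fun z hz => hsc z hz xh hxh) hmin xs hxs
  have h2 := prox_ineq f hf S hS (ContinuousLinearMap.adjoint A ys) x xs 0 μ hxs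
    (fun z hz => hsc z hz xs hxs) (by
      intro z hz
      have := hmins z hz
      simp only [ContinuousLinearMap.adjoint_inner_left]
      rw [real_inner_comm ys, real_inner_comm ys] at this
      linarith) xh hxh
  simp only [ContinuousLinearMap.adjoint_inner_left] at h1 h2
  simp only [inner_sub_left, inner_sub_right]
  rw [real_inner_comm y (A xh), real_inner_comm ys (A xh), real_inner_comm y (A xs),
    real_inner_comm ys (A xs)]
  rw [norm_sub_rev xs xh, norm_sub_rev xs x] at h1
  linarith

lemma one_step {ι F : Type*} [Fintype ι] {E : ι → Type*} [∀ i, NormedAddCommGroup (E i)]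
    [∀ i, InnerProductSpace ℝ (E i)] [∀ i, CompleteSpace (E i)]
    [NormedAddCommGroup F] [InnerProductSpace ℝ F] [CompleteSpace F]
    {p α τ η μ μb Ab dxn : ℝ} (hp : 1 ≤ p) (hμ : 0 < μ) (hμb : 0 < μb)
    (hpar : 0 < 1 - α ∧ 0 ≤ α ∧ 0 ≤ η ∧ 0 ≤ τ ∧ (1 - α) * τ = α ∧
      (1 - α) * η * p = (1 - p * (1 - α)) * μ ∧
      2 * (1 - α) ^ 2 * p ^ 2 * Ab ^ 2 = (1 - p * (1 - α)) * (μ * μb))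
    (f : ∀ i, E i → ℝ) (hf : ∀ i, Differentiable ℝ (f i)) (S : ∀ i, Set (E i))
    (hS : ∀ i, Convex ℝ (S i)) (A : ∀ i, E i →L[ℝ] F)
    (b y y' ys : F) (x xp xh xs : ∀ i, E i) (hxh : ∀ i, xh i ∈ S i) (hxs : ∀ i, xs i ∈ S i)
    (hsc : ∀ i, ∀ z ∈ S i, ∀ w ∈ S i,
      f i z - f i w - ⟪gradient (f i) w, z - w⟫ ≥ μ / 2 * ‖z - w‖ ^ 2)
    (hmin : ∀ i, ∀ z ∈ S i, f i (xh i) + ⟪ContinuousLinearMap.adjoint (A i) y, xh i⟫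
        + η / 2 * ‖xh i - x i‖ ^ 2
      ≤ f i z + ⟪ContinuousLinearMap.adjoint (A i) y, z⟫ + η / 2 * ‖z - x i‖ ^ 2)
    (hmins : ∀ i, ∀ z ∈ S i, f i (xs i) + ⟪A i (xs i), ys⟫ ≤ f i z + ⟪A i z, ys⟫)
    (h : F → ℝ) (hd : Differentiable ℝ h)
    (hhsc : ∀ y y', h y - h y' - ⟪gradient h y', y - y'⟫ ≥ μb / 2 * ‖y - y'‖ ^ 2)
    (hys : ∀ y, ⟪(∑ i, A i (xs i)) - b, y⟫ - h y ≤ ⟪(∑ i, A i (xs i)) - b, ys⟫ - h ys)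
    (hymin : ∀ z, h y + ⟪b - ∑ i, A i ((p * α) • (x i - xp i) + x i), y⟫
        + τ * (h y - h y' - ⟪gradient h y', y - y'⟫)
      ≤ h z + ⟪b - ∑ i, A i ((p * α) • (x i - xp i) + x i), z⟫
        + τ * (h z - h y' - ⟪gradient h y', z - y'⟫))
    (hq : ‖∑ i, A i (x i - xp i)‖ ≤ Ab * dxn) :
    μ / 2 * (p * ∑ i, ‖x i - xs i‖ ^ 2 - ∑ i, ‖x i - xs i‖ ^ 2 + ∑ i, ‖xh i - xs i‖ ^ 2)
      + p * (h ys - h y - ⟪gradient h y, ys - y⟫)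
      + (1 - α) * p * ⟪∑ i, A i (xh i - x i), y - ys⟫
      + (1 - α) * η * p / 2 * ∑ i, ‖xh i - x i‖ ^ 2
      ≤ p * (α * (μ / 2 * ∑ i, ‖x i - xs i‖ ^ 2 + (h ys - h y' - ⟪gradient h y', ys - y'⟫)
        + (1 - α) * p * ⟪∑ i, A i (x i - xp i), y' - ys⟫
        + (1 - α) * η * p / 2 * dxn ^ 2)) := by
  obtain ⟨he, hα, hη, hτ, hτ', hη', hkey⟩ := hpar
  set q := ∑ i, A i (x i - xp i) with hqdef
  have hg : ∑ i, A i ((p * α) • (x i - xp i) + x i) = (p * α) • q + ∑ i, A i (x i) := by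
    simp only [map_add, map_smul, Finset.sum_add_distrib, ← Finset.smul_sum, hqdef]
  rw [hg] at hymin
  have h1 := dual_step h hd _ y y' τ hymin ys
  have hsad := hys y
  apply one_step_scalar (τ := τ) (q2 := ⟪q, y - y'⟫)
    (cr := ⟪(p * α) • q + ∑ i, A i (x i) - ∑ i, A i (xs i), y - ys⟫)
    (W := h y - h y' - ⟪gradient h y', y - y'⟫) hp hμ he (by positivity) hτ' hη'
  · simp only [inner_sub_left, inner_sub_right, inner_add_left] at h1 hsad ⊢
    linarith
  · have hb := Finset.sum_le_sum (fun i (_ : i ∈ Finset.univ) => block_ineq (f i) (hf i) (S i)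
      (hS i) (A i) y ys (x i) (xh i) (xs i) η μ (hxh i) (hxs i) (hsc i) (hmin i) (hmins i))
    rw [Finset.sum_add_distrib, Finset.sum_add_distrib, ← Finset.mul_sum, ← Finset.mul_sum,
      ← Finset.mul_sum, ← sum_inner, Finset.sum_sub_distrib] at hb
    have e : ⟪(p * α) • q + ∑ i, A i (x i) - ∑ i, A i (xs i), y - ys⟫
        + ⟪∑ i, A i (xh i - x i), y - ys⟫ - p * α * (⟪q, y' - ys⟫ + ⟪q, y - y'⟫)
        = ⟪∑ i, A i (xh i) - ∑ i, A i (xs i), y - ys⟫ := by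
      simp only [map_sub, Finset.sum_sub_distrib, inner_sub_left, inner_sub_right, inner_add_left,
        real_inner_smul_left]
      ring
    rw [e]
    exact hb
  · have h3 : ⟪q, y - y'⟫ ≤ Ab * dxn * ‖y - y'‖ :=
      (real_inner_le_norm _ _).trans (mul_le_mul_of_nonneg_right hq (norm_nonneg _))
    have h4 : (p * α * Ab) * dxn * ‖y - y'‖
        ≤ (α * η * p / 2) * dxn ^ 2 + (τ * (μb / 2)) * ‖y - y'‖ ^ 2 := by
      apply young (by positivity) (by positivity)
      have : 0 ≤ (1 - α) ^ 2 * (4 * (α * η * p / 2) * (τ * (μb / 2)) - (p * α * Ab) ^ 2) := by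
        have e1 : (1 - α) ^ 2 * (4 * (α * η * p / 2) * (τ * (μb / 2)) - (p * α * Ab) ^ 2)
          = α * μb * ((1 - α) * η * p) * ((1 - α) * τ)
            - α ^ 2 * ((1 - α) ^ 2 * p ^ 2 * Ab ^ 2) := by ring
        have e2 : α * μb * ((1 - p * (1 - α)) * μ) * α
            = α ^ 2 * (2 * (1 - α) ^ 2 * p ^ 2 * Ab ^ 2) := by rw [hkey]; ring
        rw [e1, hη', hτ', e2]
        have : 0 ≤ α ^ 2 * ((1 - α) ^ 2 * p ^ 2 * Ab ^ 2) := by positivity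
        linarith
      have := nonneg_of_mul_nonneg_right this (by positivity)
      linarith
    have h5 := mul_le_mul_of_nonneg_left (hhsc y y') hτ
    have h6 := mul_le_mul_of_nonneg_left h3 (by positivity : 0 ≤ p * α)
    nlinarith

lemma dual_unique {F : Type*} [NormedAddCommGroup F] [InnerProductSpace ℝ F] [CompleteSpace F]
    (h : F → ℝ) (hd : Differentiable ℝ h) (v y y₂ y' : F) (τ μb : ℝ) (hτ : 0 ≤ τ) (hμb : 0 < μb)
    (hhsc : ∀ y y', h y - h y' - ⟪gradient h y', y - y'⟫ ≥ μb / 2 * ‖y - y'‖ ^ 2)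
    (hmin : ∀ z, h y + ⟪v, y⟫ + τ * (h y - h y' - ⟪gradient h y', y - y'⟫)
      ≤ h z + ⟪v, z⟫ + τ * (h z - h y' - ⟪gradient h y', z - y'⟫))
    (hmin₂ : ∀ z, h y₂ + ⟪v, y₂⟫ + τ * (h y₂ - h y' - ⟪gradient h y', y₂ - y'⟫)
      ≤ h z + ⟪v, z⟫ + τ * (h z - h y' - ⟪gradient h y', z - y'⟫)) : y = y₂ := by
  have h1 := dual_step h hd v y y' τ hmin y₂
  have h2 := dual_step h hd v y₂ y' τ hmin₂ y
  have h3 := hhsc y y₂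
  have h4 := hhsc y₂ y
  rw [norm_sub_rev y₂ y] at h4
  have h5 : 0 ≤ (1 + τ) * (⟪gradient h y, y₂ - y⟫ + ⟪gradient h y₂, y - y₂⟫) := by
    simp only [inner_sub_right] at h1 h2 ⊢
    nlinarith
  have h6 := nonneg_of_mul_nonneg_right h5 (by linarith)
  have h7 : μb * ‖y - y₂‖ ^ 2 ≤ 0 := by linarith
  have h8 : ‖y - y₂‖ ^ 2 ≤ 0 := nonpos_of_mul_nonpos_right h7 hμb
  have h9 : ‖y - y₂‖ = 0 := by
    apply pow_eq_zero_iff (two_ne_zero) |>.1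
    exact le_antisymm h8 (by positivity)
  exact sub_eq_zero.1 (norm_eq_zero.1 h9)

lemma prox_unique {E : Type*} [NormedAddCommGroup E] [InnerProductSpace ℝ E] [CompleteSpace E]
    (f : E → ℝ) (hf : Differentiable ℝ f) (S : Set E) (hS : Convex ℝ S) (v x' x x₂ : E) (η μ : ℝ)
    (hμ : 0 < μ) (hη : 0 ≤ η) (hx : x ∈ S) (hx₂ : x₂ ∈ S)
    (hsc : ∀ z ∈ S, ∀ w ∈ S, f z - f w - ⟪gradient f w, z - w⟫ ≥ μ / 2 * ‖z - w‖ ^ 2)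
    (hmin : ∀ z ∈ S, f x + ⟪v, x⟫ + η / 2 * ‖x - x'‖ ^ 2 ≤ f z + ⟪v, z⟫ + η / 2 * ‖z - x'‖ ^ 2)
    (hmin₂ : ∀ z ∈ S, f x₂ + ⟪v, x₂⟫ + η / 2 * ‖x₂ - x'‖ ^ 2
      ≤ f z + ⟪v, z⟫ + η / 2 * ‖z - x'‖ ^ 2) : x = x₂ := by
  have h1 := prox_ineq f hf S hS v x' x η μ hx (fun z hz => hsc z hz x hx) hmin x₂ hx₂
  have h2 := hmin₂ x hx
  have h7 : (μ + η) / 2 * ‖x₂ - x‖ ^ 2 ≤ 0 := by linarith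
  have h8 : ‖x₂ - x‖ ^ 2 ≤ 0 := nonpos_of_mul_nonpos_right h7 (by positivity)
  have h9 : ‖x₂ - x‖ = 0 := by
    apply pow_eq_zero_iff (two_ne_zero) |>.1
    exact le_antisymm h8 (by positivity)
  exact (sub_eq_zero.1 (norm_eq_zero.1 h9)).symm

/-- Conjugacy: the Bregman divergence of `h` equals that of `ψm` at the primal points. -/
lemma breg_conj {n : ℕ} (ψm h : EuclideanSpace ℝ (Fin n) → ℝ) (hψmd : Differentiable ℝ ψm)
    (hhdef : ∀ y, h y = ⨆ w : EuclideanSpace ℝ (Fin n), (⟪-y, w⟫ - ψm w))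
    (hhgrad : ∀ y w, (∀ w', ψm w + ⟪w, y⟫ ≤ ψm w' + ⟪w', y⟫) → gradient h y = -w)
    (y ys w ws : EuclideanSpace ℝ (Fin n))
    (hw : ∀ w', ψm w + ⟪w, y⟫ ≤ ψm w' + ⟪w', y⟫)
    (hws : ∀ w', ψm ws + ⟪ws, ys⟫ ≤ ψm w' + ⟪w', ys⟫) :
    breg h ys y = ψm w - ψm ws - ⟪gradient ψm ws, w - ws⟫ := by
  have hval : ∀ y w, (∀ w', ψm w + ⟪w, y⟫ ≤ ψm w' + ⟪w', y⟫) → h y = - ⟪w, y⟫ - ψm w := by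
    intro y w hw
    have hle : ∀ w', ⟪-y, w'⟫ - ψm w' ≤ - ⟪w, y⟫ - ψm w := by
      intro w'
      have := hw w'
      rw [inner_neg_left, real_inner_comm]
      linarith
    rw [hhdef]
    apply le_antisymm
    · exact ciSup_le hle
    · have := le_ciSup (f := fun w' => ⟪-y, w'⟫ - ψm w') ⟨_, by rintro _ ⟨w', rfl⟩; exact hle w'⟩ w
      refine le_trans (le_of_eq ?_) this
      simp only [inner_neg_left, real_inner_comm]
  have hvi : ∀ z, 0 ≤ ⟪gradient ψm ws, z - ws⟫ + ⟪ys, z - ws⟫ := by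
    intro z
    have := vi_of_min ψm hψmd Set.univ convex_univ ys 0 ws 0 (Set.mem_univ _) (by
      intro z _
      have := hws z
      rw [real_inner_comm, real_inner_comm _ z] at this
      linarith) z (Set.mem_univ _)
    linarith
  have h1 := hvi w
  have h2 := hvi (ws - (w - ws))
  have e : ws - (w - ws) - ws = -(w - ws) := by abel
  rw [e, inner_neg_right, inner_neg_right] at h2
  unfold breg
  rw [hhgrad y w hw, hval y w hw, hval ys ws hws]
  have h3 : ⟪gradient ψm ws, w - ws⟫ = - ⟪ys, w - ws⟫ := by linarith
  rw [h3, inner_neg_left, inner_sub_right, inner_sub_right, real_inner_comm ys w,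
    real_inner_comm ys ws]
  ring

/-- Theorem 4 (linear convergence of RaDual). -/
theorem stmt8 (m n s : ℕ) (hm : 2 ≤ m) (hn : 0 < n) (hs : 1 ≤ s)
    (d : Fin (m - 1) → ℕ) (hd : ∀ i, 0 < d i)
    (Xi : ∀ i : Fin (m - 1), Set (EuclideanSpace ℝ (Fin (d i))))
    (hXne : ∀ i, (Xi i).Nonempty) (hXcl : ∀ i, IsClosed (Xi i))
    (hXcv : ∀ i, Convex ℝ (Xi i))
    (μ Lh : ℝ) (hμ : 0 < μ) (hμL : μ ≤ Lh)
    (ψ : ∀ i : Fin (m - 1), EuclideanSpace ℝ (Fin (d i)) → ℝ)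
    (hψd : ∀ i, Differentiable ℝ (ψ i))
    (hψsc : ∀ i, ∀ x ∈ Xi i, ∀ y ∈ Xi i,
      ψ i x - ψ i y - ⟪gradient (ψ i) y, x - y⟫ ≥ μ / 2 * ‖x - y‖ ^ 2)
    (ψm : EuclideanSpace ℝ (Fin n) → ℝ) (hψmd : Differentiable ℝ ψm)
    (hψmlow : ∀ x y : EuclideanSpace ℝ (Fin n),
      μ / 2 * ‖x - y‖ ^ 2 ≤ ψm x - ψm y - ⟪gradient ψm y, x - y⟫)
    (hψmup : ∀ x y : EuclideanSpace ℝ (Fin n),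
      ψm x - ψm y - ⟪gradient ψm y, x - y⟫ ≤ Lh / 2 * ‖x - y‖ ^ 2)
    (A : ∀ i : Fin (m - 1), EuclideanSpace ℝ (Fin (d i)) →L[ℝ] EuclideanSpace ℝ (Fin n))
    (b : EuclideanSpace ℝ (Fin n))
    (Abar : ℝ) (hAbar : Abar = ⨆ i, ‖A i‖)
    (μbar : ℝ) (hμbar : μbar = 1 / Lh)
    -- the dual function `h(y) = ψ_m^*(−y)` and its properties
    (h : EuclideanSpace ℝ (Fin n) → ℝ)
    (hhdef : ∀ y, h y = ⨆ w : EuclideanSpace ℝ (Fin n), (⟪-y, w⟫ - ψm w))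
    (hhd : Differentiable ℝ h)
    (hhsc : ∀ y y', h y - h y' - ⟪gradient h y', y - y'⟫ ≥ μbar / 2 * ‖y - y'‖ ^ 2)
    (hhlip : ∀ y y', ‖gradient h y - gradient h y'‖ ≤ 1 / μ * ‖y - y'‖)
    (hhgrad : ∀ y w, (∀ w', ψm w + ⟪w, y⟫ ≤ ψm w' + ⟪w', y⟫) → gradient h y = -w)
    -- `(x*, y*)` is a saddle point of `min_{x∈X} max_y ψ(x) + ⟨𝐀x − b, y⟩ − h(y)`
    (xstar : PiLp 2 fun i : Fin (m - 1) => EuclideanSpace ℝ (Fin (d i)))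
    (ystar : EuclideanSpace ℝ (Fin n))
    (hxstarX : ∀ i, xstar i ∈ Xi i)
    (hsaddle1 : ∀ y : EuclideanSpace ℝ (Fin n),
      (∑ i, ψ i (xstar i)) + ⟪(∑ i, A i (xstar i)) - b, y⟫ - h y
        ≤ (∑ i, ψ i (xstar i)) + ⟪(∑ i, A i (xstar i)) - b, ystar⟫ - h ystar)
    (hsaddle2 : ∀ x : PiLp 2 fun i : Fin (m - 1) => EuclideanSpace ℝ (Fin (d i)),
      (∀ i, x i ∈ Xi i) →
      (∑ i, ψ i (xstar i)) + ⟪(∑ i, A i (xstar i)) - b, ystar⟫ - h ystar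
        ≤ (∑ i, ψ i (x i)) + ⟪(∑ i, A i (x i)) - b, ystar⟫ - h ystar)
    -- constant parameters of Theorem 4
    (c α τc ηc : ℝ)
    (hcdef : c = Abar ^ 2 / (μ * μbar))
    (hα : α = 1 - 2 / (((m : ℝ) - 1) * (Real.sqrt (1 + 8 * c) + 1)))
    (hτ : τc = α / (1 - α))
    (hη : ηc = (α - ((m : ℝ) - 2) / ((m : ℝ) - 1)) * μ / (1 - α))
    -- initial data
    (x0 : PiLp 2 fun i : Fin (m - 1) => EuclideanSpace ℝ (Fin (d i)))
    (hx0 : ∀ i, x0 i ∈ Xi i)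
    (xm0 : EuclideanSpace ℝ (Fin n))
    -- RaDual iterates, as functions of the random indices `ω = (i₁,…,i_s)`
    (xx : (Fin s → Fin (m - 1)) → ℕ →
      PiLp 2 fun i : Fin (m - 1) => EuclideanSpace ℝ (Fin (d i)))
    (yy : (Fin s → Fin (m - 1)) → ℕ → EuclideanSpace ℝ (Fin n))
    (hxx0 : ∀ ω, xx ω 0 = x0)
    (hyy0 : ∀ ω, yy ω 0 = -gradient ψm xm0)
    -- `yᵗ = argmin_y { h(y) + ⟨b − 𝐀x̃ᵗ, y⟩ + τ V_h(y, yᵗ⁻¹) }`,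
    -- with `x̃ᵗ = α_t(xᵗ⁻¹ − xᵗ⁻²) + xᵗ⁻¹`, `α_t = (m−1)α`, and `x⁻¹ = x⁰`
    (hyymin : ∀ ω (t : Fin s), ∀ y : EuclideanSpace ℝ (Fin n),
      h (yy ω (t.1 + 1))
          + ⟪b - ∑ i, A i (((((m : ℝ) - 1) * α) • (xx ω t.1 - xx ω (t.1 - 1))
              + xx ω t.1) i), yy ω (t.1 + 1)⟫
          + τc * breg h (yy ω (t.1 + 1)) (yy ω t.1)
        ≤ h y
          + ⟪b - ∑ i, A i (((((m : ℝ) - 1) * α) • (xx ω t.1 - xx ω (t.1 - 1))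
              + xx ω t.1) i), y⟫
          + τc * breg h y (yy ω t.1))
    -- only the randomly selected block is updated
    (hxkeep : ∀ ω (t : Fin s) (i : Fin (m - 1)), i ≠ ω t → xx ω (t.1 + 1) i = xx ω t.1 i)
    (hxmem : ∀ ω (t : Fin s), xx ω (t.1 + 1) (ω t) ∈ Xi (ω t))
    (hxmin : ∀ (ω : Fin s → Fin (m - 1)) (t : Fin s), ∀ z ∈ Xi (ω t),
      ψ (ω t) (xx ω (t.1 + 1) (ω t))
          + ⟪ContinuousLinearMap.adjoint (A (ω t)) (yy ω (t.1 + 1)),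
              xx ω (t.1 + 1) (ω t)⟫
          + ηc / 2 * ‖xx ω (t.1 + 1) (ω t) - xx ω t.1 (ω t)‖ ^ 2
        ≤ ψ (ω t) z
          + ⟪ContinuousLinearMap.adjoint (A (ω t)) (yy ω (t.1 + 1)), z⟫
          + ηc / 2 * ‖z - xx ω t.1 (ω t)‖ ^ 2)
    -- `x_mˢ = argmin_w {ψ_m(w) + ⟨w, yˢ⟩}`
    (xms : (Fin s → Fin (m - 1)) → EuclideanSpace ℝ (Fin n))
    (hxms : ∀ ω (w : EuclideanSpace ℝ (Fin n)),
      ψm (xms ω) + ⟪xms ω, yy ω s⟫ ≤ ψm w + ⟪w, yy ω s⟫)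
    -- `x_m* = argmin_w {ψ_m(w) + ⟨w, y*⟩}`
    (xmstar : EuclideanSpace ℝ (Fin n))
    (hxmstar : ∀ w : EuclideanSpace ℝ (Fin n),
      ψm xmstar + ⟪xmstar, ystar⟫ ≤ ψm w + ⟪w, ystar⟫) :
    (Fintype.card (Fin s → Fin (m - 1)) : ℝ)⁻¹ *
        ∑ ω : Fin s → Fin (m - 1),
          (‖xx ω s - xstar‖ ^ 2 + ‖xms ω - xmstar‖ ^ 2)
      ≤ α ^ s * (2 * Lh / μ) * (‖x0 - xstar‖ ^ 2 + ‖xm0 - xmstar‖ ^ 2) := by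
  obtain ⟨p, hp⟩ : ∃ p : ℝ, p = (m : ℝ) - 1 := ⟨_, rfl⟩
  have hpcast : ((m - 1 : ℕ) : ℝ) = p := by
    rw [hp, Nat.cast_sub (by omega)]; simp
  have hp1 : 1 ≤ p := by
    have : (2 : ℝ) ≤ m := by exact_mod_cast hm
    linarith
  have hp0 : 0 < p := by linarith
  have hLh : 0 < Lh := by linarith
  have hμb : 0 < μbar := by rw [hμbar]; positivity
  have hpm2 : (m : ℝ) - 2 = p - 1 := by rw [hp]; ring
  rw [hpm2, ← hp] at hη
  rw [← hp] at hα hyymin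
  have hpar := params hp1 hμ hμb hcdef hα hτ hη
  obtain ⟨he, hα0, hη0, hτ0, hτ', hη', hkey⟩ := hpar
  have hAle : ∀ i, ‖A i‖ ≤ Abar := by
    intro i
    rw [hAbar]
    exact le_ciSup (f := fun i => ‖A i‖) (Set.finite_range _).bddAbove i
  -- block optimality of `xstar`
  have hmins : ∀ i, ∀ z ∈ Xi i,
      ψ i (xstar i) + ⟪A i (xstar i), ystar⟫ ≤ ψ i z + ⟪A i z, ystar⟫ := by
    intro j z hz
    have h1 := hsaddle2 (WithLp.toLp 2 (Function.update xstar.ofLp j z)) (by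
      intro i
      by_cases hij : i = j
      · subst hij; simpa using hz
      · simpa [Function.update_of_ne hij] using hxstarX i)
    rw [sum_one_diff (fun i => ψ i ((WithLp.toLp 2 (Function.update xstar.ofLp j z)) i))
        (fun i => ψ i (xstar i)) j (fun i hi => by simp [Function.update_of_ne hi]),
      sum_one_diff (fun i => A i ((WithLp.toLp 2 (Function.update xstar.ofLp j z)) i))
        (fun i => A i (xstar i)) j (fun i hi => by simp [Function.update_of_ne hi])] at h1
    simp only [Function.update_self, inner_sub_left, inner_add_left] at h1
    linarith
  have hys : ∀ y, ⟪(∑ i, A i (xstar i)) - b, y⟫ - h y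
      ≤ ⟪(∑ i, A i (xstar i)) - b, ystar⟫ - h ystar := by
    intro y
    have := hsaddle1 y
    linarith
  -- non-anticipation
  have hystep : ∀ ω ω' (t : Fin s), xx ω t.1 = xx ω' t.1 → xx ω (t.1 - 1) = xx ω' (t.1 - 1) →
      yy ω t.1 = yy ω' t.1 → yy ω (t.1 + 1) = yy ω' (t.1 + 1) := by
    intro ω ω' t h1 h2 h3
    have m1 := hyymin ω t
    have m2 := hyymin ω' t
    rw [← h1, ← h2, ← h3] at m2
    exact dual_unique h hhd _ _ _ _ τc μbar hτ0 hμb hhsc m1 m2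
  have hxstep : ∀ ω ω' (t : Fin s), ω t = ω' t → xx ω t.1 = xx ω' t.1 →
      yy ω (t.1 + 1) = yy ω' (t.1 + 1) → xx ω (t.1 + 1) = xx ω' (t.1 + 1) := by
    intro ω ω' t h1 h2 h3
    have m1 := hxmin ω t
    have m2 := hxmin ω' t
    have k1 := hxmem ω t
    have k2 := hxmem ω' t
    rw [← h1, ← h2, ← h3] at m2
    rw [← h1] at k2
    ext1 i
    by_cases hi : i = ω t
    · subst hi
      exact prox_unique _ (hψd _) _ (hXcv _) _ _ _ _ ηc μ hμ hη0 k1 k2 (hψsc _) m1 m2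
    · rw [hxkeep ω t i hi, hxkeep ω' t i (by rwa [← h1]), h2]
  have hna : ∀ k, k ≤ s → ∀ ω ω', (∀ i : Fin s, i.1 < k → ω i = ω' i) →
      xx ω k = xx ω' k ∧ xx ω (k - 1) = xx ω' (k - 1) ∧ yy ω k = yy ω' k := by
    intro k
    induction k with
    | zero =>
      intro _ ω ω' _
      simp [hxx0, hyy0]
    | succ k ih =>
      intro hk ω ω' hag
      obtain ⟨i1, i2, i3⟩ := ih (by omega) ω ω' (fun i hi => hag i (by omega))
      have hy := hystep ω ω' ⟨k, by omega⟩ i1 i2 i3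
      exact ⟨hxstep ω ω' ⟨k, by omega⟩ (hag _ (by simp)) i1 hy, i1, hy⟩
  -- bound on the increments
  have hinc : ∀ ω k, k ≤ s → ‖∑ i, A i (xx ω k i - xx ω (k - 1) i)‖
      ≤ Abar * ‖xx ω k - xx ω (k - 1)‖ := by
    intro ω k hk
    cases k with
    | zero => simp
    | succ k =>
      have hz : ∀ i, i ≠ ω ⟨k, by omega⟩ → A i (xx ω (k + 1) i - xx ω (k + 1 - 1) i) = 0 := by
        intro i hi
        have := hxkeep ω ⟨k, by omega⟩ i hi
        simp only at this
        rw [this]; simp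
      rw [Fintype.sum_eq_single _ hz]
      refine (ContinuousLinearMap.le_opNorm _ _).trans ?_
      refine mul_le_mul (hAle _) ?_ (norm_nonneg _) ((norm_nonneg _).trans (hAle (ω ⟨k, by omega⟩)))
      exact PiLp.norm_apply_le (xx ω (k + 1) - xx ω (k + 1 - 1)) _
  -- potential function
  obtain ⟨Ψ, hΨ⟩ : ∃ Ψ : (Fin s → Fin (m - 1)) → ℕ → ℝ, ∀ ω k, Ψ ω k =
      μ / 2 * ∑ i, ‖xx ω k i - xstar i‖ ^ 2 + breg h ystar (yy ω k)
        + (1 - α) * p * ⟪∑ i, A i (xx ω k i - xx ω (k - 1) i), yy ω k - ystar⟫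
        + (1 - α) * ηc * p / 2 * ‖xx ω k - xx ω (k - 1)‖ ^ 2 := ⟨_, fun _ _ => rfl⟩
  have hstep : ∀ (t : Fin s) ω, ∑ j, Ψ (Function.update ω t j) (t.1 + 1)
      ≤ p * (α * Ψ ω t.1) := by
    intro t ω
    have hagree : ∀ j, xx (Function.update ω t j) t.1 = xx ω t.1 ∧
        xx (Function.update ω t j) (t.1 - 1) = xx ω (t.1 - 1) ∧
        yy (Function.update ω t j) t.1 = yy ω t.1 := by
      intro j
      apply hna t.1 t.2.le
      intro i hi
      rw [Function.update_of_ne]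
      rintro rfl
      omega
    have hyagree : ∀ j, yy (Function.update ω t j) (t.1 + 1) = yy ω (t.1 + 1) := by
      intro j
      obtain ⟨a1, a2, a3⟩ := hagree j
      exact hystep _ _ t a1 a2 a3
    have hkeep : ∀ j i, i ≠ j → xx (Function.update ω t j) (t.1 + 1) i = xx ω t.1 i := by
      intro j i hij
      rw [hxkeep _ t i (by simpa using hij), (hagree j).1]
    obtain ⟨xh, hxh⟩ : ∃ xh : ∀ i, EuclideanSpace ℝ (Fin (d i)),
      ∀ j, xh j = xx (Function.update ω t j) (t.1 + 1) j := ⟨_, fun _ => rfl⟩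
    have hmem : ∀ j, xh j ∈ Xi j := by
      intro j
      have := hxmem (Function.update ω t j) t
      rw [Function.update_self] at this
      rw [hxh]; exact this
    have hmin : ∀ i, ∀ z ∈ Xi i, ψ i (xh i)
          + ⟪ContinuousLinearMap.adjoint (A i) (yy ω (t.1 + 1)), xh i⟫
          + ηc / 2 * ‖xh i - xx ω t.1 i‖ ^ 2
        ≤ ψ i z + ⟪ContinuousLinearMap.adjoint (A i) (yy ω (t.1 + 1)), z⟫
          + ηc / 2 * ‖z - xx ω t.1 i‖ ^ 2 := by
      intro j
      have := hxmin (Function.update ω t j) t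
      rw [Function.update_self, hyagree, (hagree j).1] at this
      rw [hxh]; exact this
    have hone := one_step hp1 hμ hμb ⟨he, hα0, hη0, hτ0, hτ', hη', hkey⟩ ψ hψd Xi hXcv A b
      (yy ω (t.1 + 1)) (yy ω t.1) ystar (fun i => xx ω t.1 i) (fun i => xx ω (t.1 - 1) i) xh
      (fun i => xstar i) hmem hxstarX hψsc hmin hmins h hhd hhsc hys (hyymin ω t)
      (hinc ω t.1 t.2.le)
    have hL : ∀ j, Ψ (Function.update ω t j) (t.1 + 1) =
        μ / 2 * (∑ i, ‖xx ω t.1 i - xstar i‖ ^ 2 - ‖xx ω t.1 j - xstar j‖ ^ 2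
          + ‖xh j - xstar j‖ ^ 2) + breg h ystar (yy ω (t.1 + 1))
        + (1 - α) * p * ⟪A j (xh j - xx ω t.1 j), yy ω (t.1 + 1) - ystar⟫
        + (1 - α) * ηc * p / 2 * ‖xh j - xx ω t.1 j‖ ^ 2 := by
      intro j
      rw [hΨ, hyagree, Nat.add_sub_cancel, (hagree j).1, PiLp.norm_sq_eq_of_L2]
      rw [sum_one_diff (fun i => ‖xx (Function.update ω t j) (t.1 + 1) i - xstar i‖ ^ 2)
        (fun i => ‖xx ω t.1 i - xstar i‖ ^ 2) j (fun i hi => by simp only [hkeep j i hi])]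
      rw [Fintype.sum_eq_single (f := fun i =>
        A i (xx (Function.update ω t j) (t.1 + 1) i - xx ω t.1 i)) j
        (fun i hi => by simp only [hkeep j i hi, sub_self, map_zero])]
      rw [Fintype.sum_eq_single (f := fun i =>
        ‖(xx (Function.update ω t j) (t.1 + 1) - xx ω t.1) i‖ ^ 2) j
        (fun i hi => by simp [hkeep j i hi])]
      rw [PiLp.sub_apply, ← hxh]
    rw [Finset.sum_congr rfl (fun j _ => hL j), hΨ]
    refine le_trans (le_of_eq ?_) hone
    rw [sum_inner]
    simp only [Finset.sum_add_distrib, Finset.sum_sub_distrib, ← Finset.mul_sum, Finset.sum_const,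
      Finset.card_univ, Fintype.card_fin, nsmul_eq_mul, hpcast, breg]
    ring
  have hsum : ∀ k, k ≤ s → ∑ ω, Ψ ω k ≤ α ^ k * ∑ ω, Ψ ω 0 := by
    intro k
    induction k with
    | zero => intro _; simp
    | succ k ih =>
      intro hk
      have h1 := ih (by omega)
      have h2 := sum_update_avg (fun ω => Ψ ω (k + 1)) (⟨k, by omega⟩ : Fin s)
      have h3 := Finset.sum_le_sum (fun ω (_ : ω ∈ Finset.univ) => hstep ⟨k, by omega⟩ ω)
      rw [hpcast] at h2
      simp only at h3 h2
      rw [h2, ← Finset.mul_sum, ← Finset.mul_sum] at h3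
      have h4 := le_of_mul_le_mul_left h3 hp0
      calc _ ≤ _ := h4
        _ ≤ α * (α ^ k * ∑ ω, Ψ ω 0) := mul_le_mul_of_nonneg_left h1 hα0
        _ = _ := by ring
  -- initial bound
  have hinit : ∀ ω, Ψ ω 0 ≤ Lh / 2 * (‖x0 - xstar‖ ^ 2 + ‖xm0 - xmstar‖ ^ 2) := by
    intro ω
    have hw : ∀ w', ψm xm0 + ⟪xm0, yy ω 0⟫ ≤ ψm w' + ⟪w', yy ω 0⟫ := by
      intro w'
      have h1 := hψmlow w' xm0
      have h2 : 0 ≤ μ / 2 * ‖w' - xm0‖ ^ 2 := by positivity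
      rw [hyy0, inner_neg_right, inner_neg_right, real_inner_comm, real_inner_comm _ w']
      rw [inner_sub_right] at h1
      linarith
    have hb := breg_conj ψm h hψmd hhdef hhgrad (yy ω 0) ystar xm0 xmstar hw hxmstar
    have hu := hψmup xm0 xmstar
    have e : ∑ i, ‖xx ω 0 i - xstar i‖ ^ 2 = ‖x0 - xstar‖ ^ 2 := by
      rw [PiLp.norm_sq_eq_of_L2, hxx0]; rfl
    rw [hΨ, hb, e]
    have h3 : μ / 2 * ‖x0 - xstar‖ ^ 2 ≤ Lh / 2 * ‖x0 - xstar‖ ^ 2 :=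
      mul_le_mul_of_nonneg_right (by linarith) (by positivity)
    simp only [Nat.zero_sub, sub_self, map_zero, Finset.sum_const_zero, inner_zero_left, norm_zero,
      mul_zero, add_zero, ne_eq, OfNat.ofNat_ne_zero, not_false_eq_true, zero_pow]
    linarith
  -- final bound
  have hfin : ∀ ω, μ / 4 * (‖xx ω s - xstar‖ ^ 2 + ‖xms ω - xmstar‖ ^ 2) ≤ Ψ ω s := by
    intro ω
    have hb := breg_conj ψm h hψmd hhdef hhgrad (yy ω s) ystar (xms ω) xmstar (hxms ω) hxmstar
    have hl := hψmlow (xms ω) xmstar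
    rw [← hb] at hl
    have hsc := hhsc ystar (yy ω s)
    change breg h ystar (yy ω s) ≥ _ at hsc
    have e : ∑ i, ‖xx ω s i - xstar i‖ ^ 2 = ‖xx ω s - xstar‖ ^ 2 := by
      rw [PiLp.norm_sq_eq_of_L2]; rfl
    have hy := young (K := (1 - α) * p * Abar) (a := ‖xx ω s - xx ω (s - 1)‖)
      (b := ‖yy ω s - ystar‖) (u := (1 - α) * ηc * p / 2) (v := μbar / 4) (by positivity)
      (by positivity) (by rw [hη']; nlinarith [hkey])
    have hin : -⟪∑ i, A i (xx ω s i - xx ω (s - 1) i), yy ω s - ystar⟫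
        ≤ Abar * ‖xx ω s - xx ω (s - 1)‖ * ‖yy ω s - ystar‖ := by
      refine (neg_le_abs _).trans ((abs_real_inner_le_norm _ _).trans ?_)
      exact mul_le_mul_of_nonneg_right (hinc ω s le_rfl) (norm_nonneg _)
    have hin2 := mul_le_mul_of_nonneg_left hin (by positivity : 0 ≤ (1 - α) * p)
    rw [hΨ, e]
    rw [norm_sub_rev] at hsc
    have : 0 ≤ μ / 4 * ‖xx ω s - xstar‖ ^ 2 := by positivity
    linarith
  have hN : 0 < (Fintype.card (Fin s → Fin (m - 1)) : ℝ) := by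
    have : Nonempty (Fin (m - 1)) := ⟨⟨0, by omega⟩⟩
    exact_mod_cast Fintype.card_pos
  rw [inv_mul_le_iff₀ hN]
  have h1 := Finset.sum_le_sum (fun ω (_ : ω ∈ Finset.univ) => hfin ω)
  have h2 := Finset.sum_le_sum (fun ω (_ : ω ∈ Finset.univ) => hinit ω)
  rw [← Finset.mul_sum] at h1
  rw [Finset.sum_const, Finset.card_univ, nsmul_eq_mul] at h2
  have h3 := h1.trans ((hsum s le_rfl).trans
    (mul_le_mul_of_nonneg_left h2 (pow_nonneg hα0 s)))
  have h4 := mul_le_mul_of_nonneg_left h3 (by positivity : 0 ≤ 4 / μ)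
  have e1 : ∀ T : ℝ, 4 / μ * (μ / 4 * T) = T := by intro T; field_simp
  rw [e1] at h4
  refine h4.trans (le_of_eq ?_)
  field_simp
  ring
end

section
/- (Lemma 6, proximity of RapDual iterates to subproblem solutions.) Suppose the number s of inner RaDual iterations satisfies 𝓜αˢ < 1, where 𝓜 = 4 + 2L/μ. Then 𝔼[ ‖x_*^{ℓ̂} − x̄^{ℓ̂−1}‖² + ‖x_{m*}^{ℓ̂} − x̄_m^{ℓ̂−1}‖² ] ≤ D⁰/(kμ(1 − 𝓜αˢ)) and 𝔼[ ‖x_*^{ℓ̂} − x̄^{ℓ̂}‖² + ‖x_{m*}^{ℓ̂} − x̄_m^{ℓ̂}‖² ] ≤ 𝓜αˢ·D⁰/(kμ(1 − 𝓜αˢ)). -/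
open RealInnerProductSpace Finset

section helpers

variable {E : Type*} [NormedAddCommGroup E] [InnerProductSpace ℝ E]

lemma aux_norm_seg (p z c : E) (t : ℝ) :
    ‖p + t • (z - p) - c‖ ^ 2
      = (1 - t) * ‖p - c‖ ^ 2 + t * ‖z - c‖ ^ 2 - t * (1 - t) * ‖z - p‖ ^ 2 := by
  have h1 : p + t • (z - p) - c = (p - c) + t • (z - p) := by abel
  have h2 : z - c = (p - c) + (z - p) := by abel
  rw [h1, h2, norm_add_sq_real, norm_add_sq_real, norm_smul, inner_smul_right, mul_pow,
    Real.norm_eq_abs, sq_abs]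
  ring

/-- minimiser along a strongly convex segment has quadratic growth -/
lemma aux_growth (g0 g1 σ N : ℝ)
    (h : ∀ t : ℝ, 0 < t → t ≤ 1 → g0 ≤ (1 - t) * g0 + t * g1 - σ * (t * (1 - t)) + t ^ 2 * N) :
    g0 + σ ≤ g1 := by
  by_contra hcon
  push Not at hcon
  set e := g0 + σ - g1 with he
  have hepos : 0 < e := by linarith
  set B := |σ| + |N| + e + 1 with hB
  have hBpos : 0 < B := by positivity
  have hs1 := le_abs_self σ
  have hs2 := le_abs_self N
  have habs1 := abs_nonneg σ
  have habs2 := abs_nonneg N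
  set t := e / (2 * B) with ht
  have htpos : 0 < t := by positivity
  have htB : t * B = e / 2 := by rw [ht]; field_simp
  have ht1 : t ≤ 1 := by
    rw [ht, div_le_one (by positivity)]; linarith
  have h1 := h t htpos ht1
  have h2 : t * (e) ≤ t * (t * (σ + N)) := by
    rw [he]; nlinarith
  have h3 : e ≤ t * (σ + N) := le_of_mul_le_mul_left h2 htpos
  have h4 : t * (σ + N) ≤ t * B := by
    apply mul_le_mul_of_nonneg_left _ htpos.le
    linarith
  linarith

lemma aux_seg_mem {X : Set E} (hX : Convex ℝ X) {p z : E} (hp : p ∈ X) (hz : z ∈ X)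
    {t : ℝ} (h0 : 0 ≤ t) (h1 : t ≤ 1) : p + t • (z - p) ∈ X := by
  have := hX.add_smul_sub_mem hp hz ⟨h0, h1⟩
  exact this

variable [CompleteSpace E]

/-- weak convexity along segments from the gradient inequality -/
lemma aux_seg_weak {X : Set E} (hX : Convex ℝ X) (f : E → ℝ) (μ : ℝ)
    (hf : ∀ x ∈ X, ∀ y ∈ X, f x - f y - ⟪gradient f y, x - y⟫ ≥ -(μ / 2) * ‖x - y‖ ^ 2)
    {p z : E} (hp : p ∈ X) (hz : z ∈ X) {t : ℝ} (h0 : 0 ≤ t) (h1 : t ≤ 1) :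
    f (p + t • (z - p)) ≤ (1 - t) * f p + t * f z + μ / 2 * (t * (1 - t)) * ‖z - p‖ ^ 2 := by
  have hm := aux_seg_mem hX hp hz h0 h1
  set q := p + t • (z - p) with hq
  have e1 := hf p hp q hm
  have e2 := hf z hz q hm
  have d1 : p - q = (-t) • (z - p) := by rw [hq, neg_smul]; abel
  have d2 : z - q = (1 - t) • (z - p) := by rw [hq, sub_smul, one_smul]; abel
  rw [d1, inner_smul_right, norm_smul, mul_pow, Real.norm_eq_abs, sq_abs] at e1
  rw [d2, inner_smul_right, norm_smul, mul_pow, Real.norm_eq_abs, sq_abs] at e2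
  have e1' := mul_le_mul_of_nonneg_left e1 (sub_nonneg.2 h1)
  have e2' := mul_le_mul_of_nonneg_left e2 h0
  nlinarith

lemma aux_prox_growth {X : Set E} (hX : Convex ℝ X) (f : E → ℝ) (μ η : ℝ)
    (hf : ∀ x ∈ X, ∀ y ∈ X, f x - f y - ⟪gradient f y, x - y⟫ ≥ -(μ / 2) * ‖x - y‖ ^ 2)
    (c q a : E) {p : E} (hp : p ∈ X)
    (hmin : ∀ z ∈ X, f p + μ * ‖p - c‖ ^ 2 + ⟪a, p⟫ + η / 2 * ‖p - q‖ ^ 2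
      ≤ f z + μ * ‖z - c‖ ^ 2 + ⟪a, z⟫ + η / 2 * ‖z - q‖ ^ 2) {z : E} (hz : z ∈ X) :
    f p + μ * ‖p - c‖ ^ 2 + ⟪a, p⟫ + η / 2 * ‖p - q‖ ^ 2 + (μ + η) / 2 * ‖z - p‖ ^ 2
      ≤ f z + μ * ‖z - c‖ ^ 2 + ⟪a, z⟫ + η / 2 * ‖z - q‖ ^ 2 := by
  apply aux_growth _ _ _ 0
  intro t h0 h1
  have e1 := hmin _ (aux_seg_mem hX hp hz h0.le h1)
  have e2 := aux_seg_weak hX f μ hf hp hz h0.le h1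
  rw [aux_norm_seg p z c, aux_norm_seg p z q, inner_add_right, inner_smul_right,
    inner_sub_right] at e1
  refine e1.trans ?_
  linarith

/-- the descent lemma -/
lemma aux_descent (f : E → ℝ) (L : ℝ) (hd : Differentiable ℝ f)
    (hL : ∀ x y : E, ‖gradient f x - gradient f y‖ ≤ L * ‖x - y‖) (x y : E) :
    f x - f y - ⟪gradient f y, x - y⟫ ≤ L / 2 * ‖x - y‖ ^ 2 := by
  set v := x - y with hv
  set G : ℝ → ℝ := fun t => f (y + t • v) - t * ⟪gradient f y, v⟫ - L / 2 * t ^ 2 * ‖v‖ ^ 2 with hG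
  have hder : ∀ t, HasDerivAt G
      (⟪gradient f (y + t • v), v⟫ - ⟪gradient f y, v⟫ - L * t * ‖v‖ ^ 2) t := by
    intro t
    have h1 : HasDerivAt (fun t : ℝ => y + t • v) v t := by
      simpa using ((hasDerivAt_id t).smul_const v).const_add y
    have h2 := ((hd (y + t • v)).hasGradientAt.hasFDerivAt).comp_hasDerivAt t h1
    have h3 : HasDerivAt (fun t : ℝ => t * ⟪gradient f y, v⟫) ⟪gradient f y, v⟫ t := by
      simpa using (hasDerivAt_id t).mul_const ⟪gradient f y, v⟫
    have h4 : HasDerivAt (fun t : ℝ => L / 2 * t ^ 2 * ‖v‖ ^ 2) (L * t * ‖v‖ ^ 2) t := by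
      have := (((hasDerivAt_id' t).pow 2).const_mul (L / 2)).mul_const (‖v‖ ^ 2)
      refine this.congr_deriv ?_
      push_cast
      ring
    exact (h2.sub h3).sub h4
  have hanti : AntitoneOn G (Set.Icc 0 1) := by
    apply antitoneOn_of_deriv_nonpos (convex_Icc 0 1)
    · exact fun t _ => (hder t).continuousAt.continuousWithinAt
    · exact fun t _ => (hder t).differentiableAt.differentiableWithinAt
    · intro t ht
      rw [interior_Icc] at ht
      rw [(hder t).deriv, ← inner_sub_left]
      have h1 := real_inner_le_norm (gradient f (y + t • v) - gradient f y) v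
      have h2 := hL (y + t • v) y
      rw [add_sub_cancel_left, norm_smul, Real.norm_eq_abs, abs_of_pos ht.1] at h2
      have h3 := mul_le_mul_of_nonneg_right h2 (norm_nonneg v)
      nlinarith
  have := hanti (Set.left_mem_Icc.2 zero_le_one) (Set.right_mem_Icc.2 zero_le_one) zero_le_one
  simp only [hG] at this
  have hx : y + (1 : ℝ) • v = x := by rw [one_smul, hv]; abel
  rw [hx, zero_smul, add_zero] at this
  linarith

lemma aux_grad_psi (f : E → ℝ) (hd : Differentiable ℝ f) (μ : ℝ) (c w : E) :
    gradient (fun w => f w + μ * ‖w - c‖ ^ 2) w = gradient f w + (2 * μ) • (w - c) := by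
  apply HasGradientAt.gradient
  rw [hasGradientAt_iff_hasFDerivAt]
  have h1 := (hd w).hasGradientAt.hasFDerivAt
  have h2 : HasFDerivAt (fun w : E => w - c) (ContinuousLinearMap.id ℝ E) w :=
    (hasFDerivAt_id w).sub_const c
  have h3 := h1.add ((h2.norm_sq).const_mul μ)
  refine h3.congr_fderiv ?_
  ext v
  simp
  ring

lemma aux_psi_lower (f : E → ℝ) (hd : Differentiable ℝ f) (μ : ℝ) (c : E)
    (hf : ∀ x y : E, f x - f y - ⟪gradient f y, x - y⟫ ≥ -(μ / 2) * ‖x - y‖ ^ 2) (x y : E) :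
    μ / 2 * ‖x - y‖ ^ 2 ≤ (f x + μ * ‖x - c‖ ^ 2) - (f y + μ * ‖y - c‖ ^ 2)
      - ⟪gradient (fun w => f w + μ * ‖w - c‖ ^ 2) y, x - y⟫ := by
  rw [aux_grad_psi f hd, inner_add_left, inner_smul_left]
  have := hf x y
  have h2 : x - c = (y - c) + (x - y) := by abel
  rw [h2, norm_add_sq_real]
  simp only [conj_trivial]
  linarith

lemma aux_psi_upper (f : E → ℝ) (hd : Differentiable ℝ f) (μ L : ℝ) (c : E)
    (hL : ∀ x y : E, ‖gradient f x - gradient f y‖ ≤ L * ‖x - y‖) (x y : E) :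
    (f x + μ * ‖x - c‖ ^ 2) - (f y + μ * ‖y - c‖ ^ 2)
      - ⟪gradient (fun w => f w + μ * ‖w - c‖ ^ 2) y, x - y⟫ ≤ (L + 2 * μ) / 2 * ‖x - y‖ ^ 2 := by
  rw [aux_grad_psi f hd, inner_add_left, inner_smul_left]
  have := aux_descent f L hd hL x y
  have h2 : x - c = (y - c) + (x - y) := by abel
  rw [h2, norm_add_sq_real]
  simp only [conj_trivial]
  linarith

/-- an interior minimum of `κ h + ⟨a, ·⟩` -/
lemma aux_grad_zero (h : E → ℝ) (hd : Differentiable ℝ h) (κ : ℝ) (a y0 : E)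
    (hmin : ∀ y, κ * h y0 + ⟪a, y0⟫ ≤ κ * h y + ⟪a, y⟫) (v : E) :
    κ * ⟪gradient h y0, v⟫ + ⟪a, v⟫ = 0 := by
  have h1 := ((hd y0).hasGradientAt.hasFDerivAt).const_mul κ
  have h2 : HasFDerivAt (fun y : E => ⟪a, y⟫) (innerSL ℝ a) y0 := (innerSL ℝ a).hasFDerivAt
  have h3 := h1.add h2
  have hloc : IsLocalMin (fun y => κ * h y + ⟪a, y⟫) y0 := Filter.Eventually.of_forall hmin
  have h4 := hloc.hasFDerivAt_eq_zero h3
  have h5 := congrArg (fun T : E →L[ℝ] ℝ => T v) h4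
  simpa using h5

lemma aux_conj_bdd (ψ : E → ℝ) (μ : ℝ) (hμ : 0 < μ)
    (hψ : ∀ x y : E, μ / 2 * ‖x - y‖ ^ 2 ≤ ψ x - ψ y - ⟪gradient ψ y, x - y⟫) (y : E) :
    BddAbove (Set.range fun w : E => ⟪-y, w⟫ - ψ w) := by
  refine ⟨‖-y - gradient ψ 0‖ ^ 2 / (2 * μ) - ψ 0, ?_⟩
  rintro _ ⟨w, rfl⟩
  have h1 := hψ w 0
  rw [sub_zero] at h1
  have h2 := real_inner_le_norm (-y - gradient ψ 0) w
  rw [inner_sub_left] at h2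
  set K := ‖-y - gradient ψ 0‖
  have h3 : K * ‖w‖ ≤ K ^ 2 / (2 * μ) + μ / 2 * ‖w‖ ^ 2 := by
    have : K ^ 2 / (2 * μ) + μ / 2 * ‖w‖ ^ 2 - K * ‖w‖ = (K - μ * ‖w‖) ^ 2 / (2 * μ) := by
      field_simp; ring
    have h4 : 0 ≤ (K - μ * ‖w‖) ^ 2 / (2 * μ) := by positivity
    linarith
  show ⟪-y, w⟫ - ψ w ≤ _
  linarith

lemma aux_conj (ψ h : E → ℝ) (μ : ℝ) (hμ : 0 < μ)
    (hψ : ∀ x y : E, μ / 2 * ‖x - y‖ ^ 2 ≤ ψ x - ψ y - ⟪gradient ψ y, x - y⟫)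
    (hh : ∀ y, h y = ⨆ w : E, (⟪-y, w⟫ - ψ w)) (hd : Differentiable ℝ h) (y0 w0 : E)
    (hmin : ∀ w, ψ w0 + ⟪w0, y0⟫ ≤ ψ w + ⟪w, y0⟫) :
    h y0 = -⟪w0, y0⟫ - ψ w0 ∧ ∀ v, ⟪gradient h y0, v⟫ = - ⟪w0, v⟫ := by
  have h1 : h y0 = -⟪w0, y0⟫ - ψ w0 := by
    rw [hh]
    apply le_antisymm
    · apply ciSup_le
      intro w
      have := hmin w
      rw [inner_neg_left, real_inner_comm]
      linarith
    · have := le_ciSup (aux_conj_bdd ψ μ hμ hψ y0) w0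
      rw [inner_neg_left, real_inner_comm] at this
      exact this
  refine ⟨h1, fun v => ?_⟩
  have := aux_grad_zero h hd 1 w0 y0 (fun y => by
    have := le_ciSup (aux_conj_bdd ψ μ hμ hψ y) w0
    rw [← hh, inner_neg_left, real_inner_comm] at this
    rw [h1]
    linarith) v
  linarith

lemma aux_min_of_grad (ψ : E → ℝ) (μ : ℝ) (hμ : 0 < μ)
    (hψ : ∀ x y : E, μ / 2 * ‖x - y‖ ^ 2 ≤ ψ x - ψ y - ⟪gradient ψ y, x - y⟫)
    (y0 w0 : E) (hy : y0 = -gradient ψ w0) (w : E) :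
    ψ w0 + ⟪w0, y0⟫ ≤ ψ w + ⟪w, y0⟫ := by
  have h1 := hψ w w0
  have h2 : 0 ≤ μ / 2 * ‖w - w0‖ ^ 2 := by positivity
  have h3 : gradient ψ w0 = -y0 := by rw [hy, neg_neg]
  rw [h3, inner_neg_left, inner_sub_right, real_inner_comm, real_inner_comm w0] at h1
  linarith

/-- three-point identity for the `y`-step -/
lemma aux_ystep (h : E → ℝ) (hd : Differentiable ℝ h) (τ : ℝ) (a y1 y0 : E)
    (hmin : ∀ y, h y1 + ⟪a, y1⟫ + τ * (h y1 - h y0 - ⟪gradient h y0, y1 - y0⟫)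
      ≤ h y + ⟪a, y⟫ + τ * (h y - h y0 - ⟪gradient h y0, y - y0⟫)) (y : E) :
    h y1 + ⟪a, y1⟫ + τ * (h y1 - h y0 - ⟪gradient h y0, y1 - y0⟫)
      + (1 + τ) * (h y - h y1 - ⟪gradient h y1, y - y1⟫)
      = h y + ⟪a, y⟫ + τ * (h y - h y0 - ⟪gradient h y0, y - y0⟫) := by
  have := aux_grad_zero h hd (1 + τ) (a - τ • gradient h y0) y1 (fun z => by
    have := hmin z
    simp only [inner_sub_left, inner_smul_left, inner_sub_right, conj_trivial] at this ⊢
    linarith) (y - y1)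
  simp only [inner_sub_left, inner_smul_left, inner_sub_right, conj_trivial] at this ⊢
  linarith

end helpers
set_option linter.unusedSectionVars false
section blocks

variable {ι : Type*} [Fintype ι] [DecidableEq ι] {E : ι → Type*}
  [∀ i, NormedAddCommGroup (E i)] [∀ i, InnerProductSpace ℝ (E i)] [∀ i, CompleteSpace (E i)]
  {Y : Type*} [NormedAddCommGroup Y] [InnerProductSpace ℝ Y] [CompleteSpace Y]

/-- Bregman divergence, general space. -/
noncomputable def bregG (h : Y → ℝ) (x y : Y) : ℝ := h x - h y - ⟪gradient h y, x - y⟫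

lemma aux_blk_sum {M : Type*} [AddCommGroup M] (i : ι) (u x : PiLp 2 E)
    (hu : ∀ j, j ≠ i → u j = x j) (g : ∀ j, E j → M) :
    ∑ j, g j (u j) = ∑ j, g j (x j) - g i (x i) + g i (u i) := by
  rw [← Finset.add_sum_erase _ _ (Finset.mem_univ i),
    ← Finset.add_sum_erase _ (fun j => g j (x j)) (Finset.mem_univ i)]
  have : ∑ j ∈ Finset.univ.erase i, g j (u j) = ∑ j ∈ Finset.univ.erase i, g j (x j) := by
    apply Finset.sum_congr rfl
    intro j hj
    rw [hu j (Finset.ne_of_mem_erase hj)]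
  rw [this]
  abel

lemma aux_saddle (X : ∀ i, Set (E i)) (hX : ∀ i, Convex ℝ (X i)) (μ K : ℝ)
    (f : ∀ i, E i → ℝ)
    (hf : ∀ i, ∀ x ∈ X i, ∀ y ∈ X i,
      f i x - f i y - ⟪gradient (f i) y, x - y⟫ ≥ -(μ / 2) * ‖x - y‖ ^ 2)
    (ψ : Y → ℝ)
    (hψu : ∀ x y : Y, ψ x - ψ y - ⟪gradient ψ y, x - y⟫ ≤ K / 2 * ‖x - y‖ ^ 2)
    (AA : PiLp 2 E →L[ℝ] Y) (b : Y) (xb xs : PiLp 2 E) (xms lam : Y)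
    (hxs : ∀ i, xs i ∈ X i) (hfeas : AA xs + xms = b)
    (hopt : ∀ (x : PiLp 2 E) (w : Y), (∀ i, x i ∈ X i) → AA x + w = b →
      (∑ i, f i (xs i)) + μ * ‖xs - xb‖ ^ 2 + ψ xms ≤ (∑ i, f i (x i)) + μ * ‖x - xb‖ ^ 2 + ψ w)
    (hlam : lam = -gradient ψ xms) (x : PiLp 2 E) (hx : ∀ i, x i ∈ X i) :
    (∑ i, f i (xs i)) + μ * ‖xs - xb‖ ^ 2 + ⟪lam, AA xs⟫ + μ / 2 * ‖x - xs‖ ^ 2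
      ≤ (∑ i, f i (x i)) + μ * ‖x - xb‖ ^ 2 + ⟪lam, AA x⟫ := by
  apply aux_growth _ _ _ (K / 2 * ‖AA (x - xs)‖ ^ 2)
  intro t h0 h1
  have e1 := hopt (xs + t • (x - xs)) (b - AA (xs + t • (x - xs)))
    (fun i => aux_seg_mem (hX i) (hxs i) (hx i) h0.le h1) (by abel)
  have e2 : ∑ i, f i ((xs + t • (x - xs)) i)
      ≤ ∑ i, ((1 - t) * f i (xs i) + t * f i (x i)
        + μ / 2 * (t * (1 - t)) * ‖x i - xs i‖ ^ 2) :=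
    Finset.sum_le_sum fun i _ => aux_seg_weak (hX i) (f i) μ (hf i) (hxs i) (hx i) h0.le h1
  rw [Finset.sum_add_distrib, Finset.sum_add_distrib, ← Finset.mul_sum, ← Finset.mul_sum,
    ← Finset.mul_sum] at e2
  have e3 : ∑ i, ‖x i - xs i‖ ^ 2 = ‖x - xs‖ ^ 2 := by
    rw [PiLp.norm_sq_eq_of_L2]; rfl
  rw [e3] at e2
  have e4 := hψu (b - AA (xs + t • (x - xs))) xms
  have e5 : b - AA (xs + t • (x - xs)) - xms = -(t • AA (x - xs)) := by
    rw [← hfeas, map_add, map_smul]; abel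
  have hg : gradient ψ xms = -lam := by rw [hlam, neg_neg]
  rw [e5, hg, inner_neg_neg, inner_smul_right, norm_neg, norm_smul, mul_pow, Real.norm_eq_abs,
    sq_abs, map_sub, inner_sub_right] at e4
  rw [aux_norm_seg xs x xb] at e1
  rw [map_sub]
  linarith

lemma aux_opt_unique (X : ∀ i, Set (E i)) (hX : ∀ i, Convex ℝ (X i)) (μ K : ℝ) (hμ : 0 < μ)
    (f : ∀ i, E i → ℝ)
    (hf : ∀ i, ∀ x ∈ X i, ∀ y ∈ X i,
      f i x - f i y - ⟪gradient (f i) y, x - y⟫ ≥ -(μ / 2) * ‖x - y‖ ^ 2)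
    (ψ : Y → ℝ)
    (hψu : ∀ x y : Y, ψ x - ψ y - ⟪gradient ψ y, x - y⟫ ≤ K / 2 * ‖x - y‖ ^ 2)
    (hψl : ∀ x y : Y, μ / 2 * ‖x - y‖ ^ 2 ≤ ψ x - ψ y - ⟪gradient ψ y, x - y⟫)
    (AA : PiLp 2 E →L[ℝ] Y) (b : Y) (xb xs : PiLp 2 E) (xms : Y)
    (hxs : ∀ i, xs i ∈ X i) (hfeas : AA xs + xms = b)
    (hopt : ∀ (x : PiLp 2 E) (w : Y), (∀ i, x i ∈ X i) → AA x + w = b →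
      (∑ i, f i (xs i)) + μ * ‖xs - xb‖ ^ 2 + ψ xms ≤ (∑ i, f i (x i)) + μ * ‖x - xb‖ ^ 2 + ψ w)
    (xs' : PiLp 2 E) (xms' : Y)
    (hxs' : ∀ i, xs' i ∈ X i) (hfeas' : AA xs' + xms' = b)
    (hopt' : ∀ (x : PiLp 2 E) (w : Y), (∀ i, x i ∈ X i) → AA x + w = b →
      (∑ i, f i (xs' i)) + μ * ‖xs' - xb‖ ^ 2 + ψ xms'
        ≤ (∑ i, f i (x i)) + μ * ‖x - xb‖ ^ 2 + ψ w) :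
    xs' = xs ∧ xms' = xms := by
  have h1 := aux_saddle X hX μ K f hf ψ hψu AA b xb xs xms _ hxs hfeas hopt rfl xs' hxs'
  have h2 := hψl xms' xms
  have h3 := hopt' xs xms hxs hfeas
  have h4 : xms' - xms = AA xs - AA xs' := by
    rw [eq_sub_iff_add_eq.2 ((add_comm _ _).trans hfeas'),
      eq_sub_iff_add_eq.2 ((add_comm _ _).trans hfeas)]
    abel
  have h5 : ⟪gradient ψ xms, xms' - xms⟫ = ⟪gradient ψ xms, AA xs⟫ - ⟪gradient ψ xms, AA xs'⟫ := by
    rw [h4, inner_sub_right]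
  rw [inner_neg_left, inner_neg_left] at h1
  have h6 : μ / 2 * (‖xs' - xs‖ ^ 2 + ‖xms' - xms‖ ^ 2) ≤ 0 := by linarith
  have h7 : ‖xs' - xs‖ ^ 2 + ‖xms' - xms‖ ^ 2 ≤ 0 := by
    by_contra hc
    push Not at hc
    have : 0 < μ / 2 * (‖xs' - xs‖ ^ 2 + ‖xms' - xms‖ ^ 2) := by positivity
    linarith
  have h8 := sq_nonneg ‖xs' - xs‖
  have h9 := sq_nonneg ‖xms' - xms‖
  constructor
  · have : ‖xs' - xs‖ ^ 2 = 0 := by linarith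
    exact sub_eq_zero.1 (norm_eq_zero.1 (pow_eq_zero_iff two_ne_zero |>.1 this))
  · have : ‖xms' - xms‖ ^ 2 = 0 := by linarith
    exact sub_eq_zero.1 (norm_eq_zero.1 (pow_eq_zero_iff two_ne_zero |>.1 this))

lemma aux_cross (p β η Ab Lh D : ℝ) (hp : 0 ≤ p) (hβ : 0 < β) (hLh : 0 < Lh)
    (hη : η * β = 2 * p * Ab ^ 2 * Lh) (δ v : Y) (hv : ‖v‖ ≤ Ab * D) :
    |p * ⟪δ, v⟫| ≤ β / (4 * Lh) * ‖δ‖ ^ 2 + p * η / 2 * D ^ 2 := by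
  rw [abs_mul, abs_of_nonneg hp]
  have h1 : |⟪δ, v⟫| ≤ ‖δ‖ * (Ab * D) :=
    (abs_real_inner_le_norm δ v).trans (mul_le_mul_of_nonneg_left hv (norm_nonneg _))
  refine (mul_le_mul_of_nonneg_left h1 hp).trans ?_
  have hη' : η = 2 * p * Ab ^ 2 * Lh / β := by field_simp; linarith
  have : β / (4 * Lh) * ‖δ‖ ^ 2 + p * η / 2 * D ^ 2 - p * (‖δ‖ * (Ab * D))
      = (β * ‖δ‖ - 2 * p * Ab * Lh * D) ^ 2 / (4 * Lh * β) := by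
    rw [hη']; field_simp; ring
  have h4 : 0 ≤ (β * ‖δ‖ - 2 * p * Ab * Lh * D) ^ 2 / (4 * Lh * β) := by positivity
  linarith

/-- the potential function -/
noncomputable def PhiG (h : Y → ℝ) (lam : Y) (xs : PiLp 2 E) (AA : PiLp 2 E →L[ℝ] Y)
    (p τ μ η : ℝ) (x xp : PiLp 2 E) (y : Y) : ℝ :=
  (1 + τ) * bregG h lam y + μ * (1 + τ) / 2 * ‖x - xs‖ ^ 2 + p * ⟪y - lam, AA (x - xp)⟫
    + p * η / 2 * ‖x - xp‖ ^ 2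

lemma aux_step (X : ∀ i, Set (E i)) (hX : ∀ i, Convex ℝ (X i)) (μ : ℝ)
    (f : ∀ i, E i → ℝ)
    (hf : ∀ i, ∀ x ∈ X i, ∀ y ∈ X i,
      f i x - f i y - ⟪gradient (f i) y, x - y⟫ ≥ -(μ / 2) * ‖x - y‖ ^ 2)
    (A : ∀ i, E i →L[ℝ] Y) (AA : PiLp 2 E →L[ℝ] Y) (hAA : ∀ x, AA x = ∑ i, A i (x i))
    (b : Y) (xb xs : PiLp 2 E) (xms lam : Y)
    (hxs : ∀ i, xs i ∈ X i) (hfeas : AA xs + xms = b)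
    (hsad : ∀ x : PiLp 2 E, (∀ i, x i ∈ X i) →
      (∑ i, f i (xs i)) + μ * ‖xs - xb‖ ^ 2 + ⟪lam, AA xs⟫
        ≤ (∑ i, f i (x i)) + μ * ‖x - xb‖ ^ 2 + ⟪lam, AA x⟫)
    (h : Y → ℝ) (hd : Differentiable ℝ h) (Lh : ℝ) (hLh : 0 < Lh)
    (hsc : ∀ y y', (1 / Lh) / 2 * ‖y - y'‖ ^ 2 ≤ bregG h y y')
    (hlamg : ∀ v, ⟪gradient h lam, v⟫ = -⟪xms, v⟫)
    (p τ η α Ab : ℝ) (hp : p = Fintype.card ι) (hτ : 0 ≤ τ) (hα : 0 ≤ α)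
    (hατ : α * (1 + τ) = τ) (hη : η * (1 + τ) = 2 * p * Ab ^ 2 * Lh)
    (hpη : p * (μ + η) = μ * (1 + τ))
    (x xp : PiLp 2 E) (hblk : ‖AA (x - xp)‖ ≤ Ab * ‖x - xp‖) (y y1 : Y)
    (hy : ∀ z, h y1 + ⟪b - AA ((p * α) • (x - xp) + x), y1⟫ + τ * bregG h y1 y
      ≤ h z + ⟪b - AA ((p * α) • (x - xp) + x), z⟫ + τ * bregG h z y)
    (xn : ι → PiLp 2 E) (hkeep : ∀ i j, j ≠ i → xn i j = x j)
    (hmem : ∀ i, xn i i ∈ X i)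
    (hmin : ∀ i, ∀ z ∈ X i,
      f i (xn i i) + μ * ‖xn i i - xb i‖ ^ 2 + ⟪ContinuousLinearMap.adjoint (A i) y1, xn i i⟫
          + η / 2 * ‖xn i i - x i‖ ^ 2
        ≤ f i z + μ * ‖z - xb i‖ ^ 2 + ⟪ContinuousLinearMap.adjoint (A i) y1, z⟫
          + η / 2 * ‖z - x i‖ ^ 2) :
    ∑ i, PhiG h lam xs AA p τ μ η (xn i) x y1 ≤ p * (α * PhiG h lam xs AA p τ μ η x xp y) := by
  have hp0 : 0 ≤ p := by rw [hp]; positivity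
  set u : PiLp 2 E := WithLp.toLp 2 (fun i => xn i i) with hu
  have hui : ∀ i, u i = xn i i := fun i => rfl
  -- the `y` step
  have hY : h y1 + ⟪b - AA ((p * α) • (x - xp) + x), y1⟫ + τ * bregG h y1 y
      + (1 + τ) * bregG h lam y1
      = h lam + ⟪b - AA ((p * α) • (x - xp) + x), lam⟫ + τ * bregG h lam y :=
    aux_ystep h hd τ _ y1 y hy lam
  have hYl : h y1 - h lam - ⟪gradient h lam, y1 - lam⟫ ≥ 0 := by
    have h1 := hsc y1 lam
    have h2 : 0 ≤ (1 / Lh) / 2 * ‖y1 - lam‖ ^ 2 := by positivity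
    exact h2.trans h1
  rw [hlamg] at hYl
  -- the `x` step
  have hXs : ∑ i, (f i (xn i i) + μ * ‖xn i i - xb i‖ ^ 2
          + ⟪y1, A i (xn i i)⟫
          + η / 2 * ‖xn i i - x i‖ ^ 2 + (μ + η) / 2 * ‖xs i - xn i i‖ ^ 2)
      ≤ ∑ i, (f i (xs i) + μ * ‖xs i - xb i‖ ^ 2 + ⟪y1, A i (xs i)⟫
          + η / 2 * ‖xs i - x i‖ ^ 2) := by
    apply Finset.sum_le_sum
    intro i _
    have := aux_prox_growth (hX i) (f i) μ η (hf i) (xb i) (x i) _ (hmem i) (hmin i) (hxs i)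
    rwa [ContinuousLinearMap.adjoint_inner_left, ContinuousLinearMap.adjoint_inner_left] at this
  simp only [Finset.sum_add_distrib, ← Finset.mul_sum, ← inner_sum] at hXs
  have n1 : ∀ a c : PiLp 2 E, ∑ i, ‖a i - c i‖ ^ 2 = ‖a - c‖ ^ 2 := by
    intro a c
    rw [PiLp.norm_sq_eq_of_L2]; rfl
  have n2 : ∀ c : PiLp 2 E, ∑ i, ‖xn i i - c i‖ ^ 2 = ‖u - c‖ ^ 2 := fun c => n1 u c
  have n3 : ∑ i, ‖xs i - xn i i‖ ^ 2 = ‖xs - u‖ ^ 2 := n1 xs u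
  have n4 : ∑ i, A i (xn i i) = AA u := (hAA u).symm
  rw [n1, n1, n2, n2, n3, n4, ← hAA] at hXs
  have hS := hsad u hmem
  simp only [hui] at hS
  -- sums over the blocks
  have s1 : ∀ i, ‖xn i - xs‖ ^ 2 = ‖x - xs‖ ^ 2 - ‖x i - xs i‖ ^ 2 + ‖xn i i - xs i‖ ^ 2 := by
    intro i
    rw [← n1, ← n1]
    exact aux_blk_sum i (xn i) x (hkeep i) (fun j z => ‖z - xs j‖ ^ 2)
  have s2 : ∀ i, ‖xn i - x‖ ^ 2 = ‖xn i i - x i‖ ^ 2 := by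
    intro i
    rw [← n1]
    rw [aux_blk_sum i (xn i) x (hkeep i) (fun j z => ‖z - x j‖ ^ 2)]
    simp
  have s3 : ∀ i, AA (xn i - x) = A i (xn i i) - A i (x i) := by
    intro i
    rw [map_sub, hAA, hAA, aux_blk_sum i (xn i) x (hkeep i) (fun j z => A j z)]
    abel
  have t1 : ∑ i, ‖xn i - xs‖ ^ 2 = (p - 1) * ‖x - xs‖ ^ 2 + ‖u - xs‖ ^ 2 := by
    simp only [s1]
    rw [Finset.sum_add_distrib, Finset.sum_sub_distrib, n1, n2, Finset.sum_const, Finset.card_univ,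
      nsmul_eq_mul, ← hp]
    ring
  have t2 : ∑ i, ‖xn i - x‖ ^ 2 = ‖u - x‖ ^ 2 := by
    simp only [s2]; rw [n2]
  have t3 : ∑ i, AA (xn i - x) = AA u - AA x := by
    simp only [s3]
    rw [Finset.sum_sub_distrib, n4, ← hAA]
  have hsum : ∑ i, PhiG h lam xs AA p τ μ η (xn i) x y1
      = p * ((1 + τ) * bregG h lam y1) + μ * (1 + τ) / 2 * ((p - 1) * ‖x - xs‖ ^ 2 + ‖u - xs‖ ^ 2)
        + p * ⟪y1 - lam, AA u - AA x⟫ + p * η / 2 * ‖u - x‖ ^ 2 := by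
    unfold PhiG
    rw [Finset.sum_add_distrib, Finset.sum_add_distrib, Finset.sum_add_distrib, ← Finset.mul_sum,
      ← Finset.mul_sum, ← Finset.mul_sum, ← Finset.mul_sum, t1, t2, ← inner_sum, t3,
      Finset.sum_const, Finset.card_univ, nsmul_eq_mul, ← hp]
    ring
  rw [hsum]
  -- cross term
  have hc := aux_cross p (1 + τ) η Ab Lh ‖x - xp‖ hp0 (by linarith) hLh hη (y1 - y) _ hblk
  have hc2 := hsc y1 y
  have hc3 : p * ⟪y1 - y, AA (x - xp)⟫ ≤ (1 + τ) * bregG h y1 y + p * η / 2 * ‖x - xp‖ ^ 2 := by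
    refine (le_abs_self _).trans (hc.trans ?_)
    have h1 : (1 + τ) / (4 * Lh) * ‖y1 - y‖ ^ 2 ≤ (1 + τ) * (1 / Lh / 2 * ‖y1 - y‖ ^ 2) := by
      have e : (1 + τ) * (1 / Lh / 2 * ‖y1 - y‖ ^ 2) - (1 + τ) / (4 * Lh) * ‖y1 - y‖ ^ 2
        = (1 + τ) / (4 * Lh) * ‖y1 - y‖ ^ 2 := by field_simp; ring
      have : 0 ≤ (1 + τ) / (4 * Lh) * ‖y1 - y‖ ^ 2 := by positivity
      linarith
    have h2 := mul_le_mul_of_nonneg_left hc2 (by linarith : 0 ≤ 1 + τ)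
    linarith
  have hc4 := mul_le_mul_of_nonneg_left hc3 hα
  have hc5 : α * ((1 + τ) * bregG h y1 y) = τ * bregG h y1 y := by rw [← mul_assoc, hατ]
  have hc6 : α * ((1 + τ) * bregG h lam y) = τ * bregG h lam y := by rw [← mul_assoc, hατ]
  -- put everything together
  have hb : b = AA xs + xms := hfeas.symm
  have key : (1 + τ) * bregG h lam y1 + (μ + η) / 2 * ‖u - xs‖ ^ 2 + ⟪y1 - lam, AA u - AA x⟫
      + η / 2 * ‖u - x‖ ^ 2 ≤ τ * bregG h lam y + η / 2 * ‖x - xs‖ ^ 2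
        + α * (p * ⟪y - lam, AA (x - xp)⟫) + α * (p * η / 2 * ‖x - xp‖ ^ 2) := by
    rw [norm_sub_rev xs u, norm_sub_rev xs x] at hXs
    have e1 : AA ((p * α) • (x - xp) + x) = (p * α) • AA (x - xp) + AA x := by
      rw [map_add, map_smul]
    have q : ∀ z, ⟪b - AA ((p * α) • (x - xp) + x), z⟫ = ⟪z, AA xs⟫ + ⟪xms, z⟫
        - p * α * ⟪z, AA (x - xp)⟫ - ⟪z, AA x⟫ := by
      intro z
      rw [e1, hb, inner_sub_left, inner_add_left, inner_add_left, inner_smul_left,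
        real_inner_comm z (AA xs), real_inner_comm z (AA (x - xp)), real_inner_comm z (AA x)]
      simp only [conj_trivial]
      ring
    rw [q, q] at hY
    rw [inner_sub_right] at hYl
    rw [inner_sub_left] at hc4
    rw [inner_sub_left, inner_sub_left, inner_sub_right, inner_sub_right]
    linarith
  unfold PhiG
  have hk := mul_le_mul_of_nonneg_left key hp0
  have k1 : p * ((μ + η) / 2 * ‖u - xs‖ ^ 2) = μ * (1 + τ) / 2 * ‖u - xs‖ ^ 2 := by
    rw [← hpη]; ring
  have k2 : p * (η / 2 * ‖x - xs‖ ^ 2) + μ * (1 + τ) / 2 * ((p - 1) * ‖x - xs‖ ^ 2)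
      = p * (α * (μ * (1 + τ) / 2 * ‖x - xs‖ ^ 2)) := by
    have : p * η + μ * (1 + τ) * (p - 1) = p * μ * (α * (1 + τ)) := by
      rw [hατ]; linarith
    linear_combination (‖x - xs‖ ^ 2 / 2) * this
  linarith [congrArg (fun z => p * z) hc6]

end blocks
section misc

lemma aux_params (p μ Lh Ab c α τ η : ℝ) (hp : 1 ≤ p) (hμ : 0 < μ) (hLh : 0 < Lh)
    (hc : c = Lh * Ab ^ 2 / μ) (hα : α = 1 - 2 / (p * (Real.sqrt (1 + 8 * c) + 1)))
    (hτ : τ = α / (1 - α)) (hη : η = (α - (p - 1) / p) * μ / (1 - α)) :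
    0 ≤ τ ∧ 0 ≤ α ∧ 0 ≤ η ∧ α * (1 + τ) = τ ∧ η * (1 + τ) = 2 * p * Ab ^ 2 * Lh ∧
      p * (μ + η) = μ * (1 + τ) := by
  have hc0 : 0 ≤ c := by rw [hc]; positivity
  set q := Real.sqrt (1 + 8 * c) with hq
  have hq2 : q ^ 2 = 1 + 8 * c := Real.sq_sqrt (by linarith)
  have hq0 : 0 ≤ q := Real.sqrt_nonneg _
  have hq1 : 1 ≤ q := by nlinarith
  have hp0 : 0 < p := by linarith
  have h1 : 1 - α = 2 / (p * (q + 1)) := by rw [hα]; ring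
  have hpos : 0 < p * (q + 1) := by positivity
  have hα0 : 0 ≤ α := by
    rw [hα, sub_nonneg, div_le_one hpos]; nlinarith
  have hτ1 : 1 + τ = p * (q + 1) / 2 := by
    have : 1 - α ≠ 0 := by rw [h1]; positivity
    have h2 : 1 + τ = 1 / (1 - α) := by rw [hτ]; field_simp; ring
    rw [h2, h1]; field_simp
  have hη1 : η = (q - 1) * μ / 2 := by
    have h2 : α - (p - 1) / p = (q - 1) / (p * (q + 1)) := by rw [hα]; field_simp; ring
    rw [hη, h1, h2]; field_simp
  have hcm : c * μ = Lh * Ab ^ 2 := by rw [hc]; field_simp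
  refine ⟨?_, hα0, ?_, ?_, ?_, ?_⟩
  · have : 1 ≤ 1 + τ := by rw [hτ1]; nlinarith
    linarith
  · rw [hη1]
    have : 0 ≤ q - 1 := by linarith
    positivity
  · have : 1 - α ≠ 0 := by rw [h1]; positivity
    rw [hτ]; field_simp; ring
  · rw [hη1, hτ1]
    linear_combination (p * μ / 4) * hq2 + 2 * p * hcm
  · rw [hη1, hτ1]; ring

/-- resampling one coordinate -/
def updIdx {k s : ℕ} {ι : Type*} (ω : Fin k → Fin s → ι) (l : Fin k) (t : Fin s) (i : ι) :
    Fin k → Fin s → ι := Function.update ω l (Function.update (ω l) t i)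

lemma updIdx_same {k s : ℕ} {ι : Type*} (ω : Fin k → Fin s → ι) (l : Fin k) (t : Fin s) (i : ι) :
    updIdx ω l t i l t = i := by simp [updIdx]

lemma updIdx_t {k s : ℕ} {ι : Type*} (ω : Fin k → Fin s → ι) (l : Fin k) (t t' : Fin s) (i : ι)
    (h : t' ≠ t) : updIdx ω l t i l t' = ω l t' := by simp [updIdx, h]

lemma updIdx_l {k s : ℕ} {ι : Type*} (ω : Fin k → Fin s → ι) (l l' : Fin k) (t : Fin s) (i : ι)
    (h : l' ≠ l) : updIdx ω l t i l' = ω l' := by simp [updIdx, h]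

lemma updIdx_upd {k s : ℕ} {ι : Type*} (ω : Fin k → Fin s → ι) (l : Fin k) (t : Fin s) (i : ι) :
    updIdx (updIdx ω l t i) l t (ω l t) = ω := by
  simp [updIdx]

lemma aux_avg {k s : ℕ} {ι : Type*} [Fintype ι] [DecidableEq ι] (G : (Fin k → Fin s → ι) → ℝ)
    (l : Fin k) (t : Fin s) :
    ∑ ω, ∑ i, G (updIdx ω l t i) = (Fintype.card ι : ℝ) * ∑ ω, G ω := by
  have hinv : Function.Involutive
      (fun z : (Fin k → Fin s → ι) × ι => (updIdx z.1 l t z.2, z.1 l t)) := by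
    rintro ⟨ω, i⟩
    simp [updIdx_upd, updIdx_same]
  have h1 := Equiv.sum_comp hinv.toPerm (fun z => G z.1)
  rw [Fintype.sum_prod_type, Fintype.sum_prod_type] at h1
  simp only [Finset.sum_const, Finset.card_univ, nsmul_eq_mul, ← Finset.mul_sum] at h1
  rw [← h1]
  rfl

lemma aux_tele (k : ℕ) (F a e : Fin (k + 1) → ℝ) (F0 μ : ℝ) (h0 : F 0 + μ * a 0 ≤ F0)
    (hstep : ∀ j : Fin k, F j.succ + μ * a j.succ ≤ F j.castSucc + μ * e j.castSucc) :
    F (Fin.last k) + μ * ∑ j, a j ≤ F0 + μ * ∑ j : Fin k, e j.castSucc := by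
  induction k with
  | zero => simpa using h0
  | succ k ih =>
    have h1 := ih (fun j => F j.castSucc) (fun j => a j.castSucc) (fun j => e j.castSucc)
      (by simpa using h0) (fun j => by simpa using hstep j.castSucc)
    have h2 := hstep (Fin.last k)
    rw [Fin.sum_univ_castSucc a, Fin.sum_univ_castSucc (fun j : Fin (k + 1) => e j.castSucc)]
    rw [Fin.succ_last] at h2
    linarith

lemma aux_tele' (k : ℕ) (hk : 1 ≤ k) (F a e : Fin k → ℝ) (F0 Fo μ : ℝ) (hμ : 0 ≤ μ)
    (he : ∀ j, 0 ≤ e j) (hF : ∀ j, Fo ≤ F j)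
    (h0 : ∀ j : Fin k, j.1 = 0 → F j + μ * a j ≤ F0)
    (hstep : ∀ j j' : Fin k, j'.1 = j.1 + 1 → F j' + μ * a j' ≤ F j + μ * e j) :
    μ * ∑ j, a j ≤ F0 - Fo + μ * ∑ j, e j := by
  obtain ⟨k, rfl⟩ : ∃ k', k = k' + 1 := ⟨k - 1, by omega⟩
  have h1 := aux_tele k F a e F0 μ (h0 0 rfl) (fun j => hstep _ _ (by simp))
  rw [Fin.sum_univ_castSucc e]
  have h2 := mul_nonneg hμ (he (Fin.last k))
  have h3 := hF (Fin.last k)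
  linarith

variable {E : Type*} [NormedAddCommGroup E] [InnerProductSpace ℝ E] [CompleteSpace E]

lemma aux_eq_of_sq (κ : ℝ) (hκ : 0 < κ) (x y : E) (h : κ * ‖x - y‖ ^ 2 ≤ 0) : x = y := by
  by_contra hne
  have : 0 < ‖x - y‖ := norm_pos_iff.2 (sub_ne_zero.2 hne)
  have : 0 < κ * ‖x - y‖ ^ 2 := by positivity
  linarith

lemma aux_y_unique (h : E → ℝ) (hd : Differentiable ℝ h) (τ κ : ℝ) (hτ : 0 ≤ τ) (hκ : 0 < κ)
    (hsc : ∀ y y', κ * ‖y - y'‖ ^ 2 ≤ bregG h y y') (a y0 y1 y2 : E)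
    (h1 : ∀ y, h y1 + ⟪a, y1⟫ + τ * bregG h y1 y0 ≤ h y + ⟪a, y⟫ + τ * bregG h y y0)
    (h2 : ∀ y, h y2 + ⟪a, y2⟫ + τ * bregG h y2 y0 ≤ h y + ⟪a, y⟫ + τ * bregG h y y0) :
    y2 = y1 := by
  have e1 : h y1 + ⟪a, y1⟫ + τ * bregG h y1 y0 + (1 + τ) * bregG h y2 y1
      = h y2 + ⟪a, y2⟫ + τ * bregG h y2 y0 := aux_ystep h hd τ a y1 y0 h1 y2
  have e2 := h2 y1
  have e3 := mul_le_mul_of_nonneg_left (hsc y2 y1) (by linarith : 0 ≤ 1 + τ)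
  apply aux_eq_of_sq ((1 + τ) * κ) (by positivity)
  linarith

lemma aux_prox_unique {X : Set E} (hX : Convex ℝ X) (f : E → ℝ) (μ η : ℝ) (hμ : 0 < μ)
    (hη : 0 ≤ η)
    (hf : ∀ x ∈ X, ∀ y ∈ X, f x - f y - ⟪gradient f y, x - y⟫ ≥ -(μ / 2) * ‖x - y‖ ^ 2)
    (c q a : E) {p p' : E} (hp : p ∈ X) (hp' : p' ∈ X)
    (hmin : ∀ z ∈ X, f p + μ * ‖p - c‖ ^ 2 + ⟪a, p⟫ + η / 2 * ‖p - q‖ ^ 2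
      ≤ f z + μ * ‖z - c‖ ^ 2 + ⟪a, z⟫ + η / 2 * ‖z - q‖ ^ 2)
    (hmin' : ∀ z ∈ X, f p' + μ * ‖p' - c‖ ^ 2 + ⟪a, p'⟫ + η / 2 * ‖p' - q‖ ^ 2
      ≤ f z + μ * ‖z - c‖ ^ 2 + ⟪a, z⟫ + η / 2 * ‖z - q‖ ^ 2) : p = p' := by
  have h1 := aux_prox_growth hX f μ η hf c q a hp hmin hp'
  have h2 := hmin' p hp
  symm
  apply aux_eq_of_sq ((μ + η) / 2) (by positivity)
  linarith

/-- Bregman divergence of the conjugate as a Bregman divergence of the primal function -/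
lemma aux_breg_conj (ψ h : E → ℝ) (μ : ℝ) (hμ : 0 < μ)
    (hψ : ∀ x y : E, μ / 2 * ‖x - y‖ ^ 2 ≤ ψ x - ψ y - ⟪gradient ψ y, x - y⟫)
    (hh : ∀ y, h y = ⨆ w : E, (⟪-y, w⟫ - ψ w)) (hd : Differentiable ℝ h) (lam ws y w : E)
    (hlam : lam = -gradient ψ ws) (hmin : ∀ v, ψ w + ⟪w, y⟫ ≤ ψ v + ⟪v, y⟫) :
    bregG h lam y = ψ w - ψ ws - ⟪gradient ψ ws, w - ws⟫ := by
  obtain ⟨h1, h2⟩ := aux_conj ψ h μ hμ hψ hh hd y w hmin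
  obtain ⟨h3, -⟩ := aux_conj ψ h μ hμ hψ hh hd lam ws (aux_min_of_grad ψ μ hμ hψ lam ws hlam)
  have hg : gradient ψ ws = -lam := by rw [hlam, neg_neg]
  rw [bregG, h2, h1, h3, hg, inner_neg_left, inner_sub_right, inner_sub_right,
    real_inner_comm w lam, real_inner_comm ws lam]
  ring

end misc
/-- Lemma 6 (proximity of RapDual iterates to subproblem solutions). -/
theorem stmt9 (m n k s : ℕ) (hm : 2 ≤ m) (hn : 0 < n) (hk : 1 ≤ k) (hs : 1 ≤ s)
    (d : Fin (m - 1) → ℕ) (hd : ∀ i, 0 < d i)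
    (Xi : ∀ i : Fin (m - 1), Set (EuclideanSpace ℝ (Fin (d i))))
    (hXne : ∀ i, (Xi i).Nonempty) (hXcl : ∀ i, IsClosed (Xi i))
    (hXcv : ∀ i, Convex ℝ (Xi i))
    (μ L : ℝ) (hμ : 0 < μ) (hμL : μ ≤ L)
    (f : ∀ i : Fin (m - 1), EuclideanSpace ℝ (Fin (d i)) → ℝ)
    (hfd : ∀ i, Differentiable ℝ (f i))
    (hfw : ∀ i, ∀ x ∈ Xi i, ∀ y ∈ Xi i,
      f i x - f i y - ⟪gradient (f i) y, x - y⟫ ≥ -(μ / 2) * ‖x - y‖ ^ 2)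
    (fm : EuclideanSpace ℝ (Fin n) → ℝ) (hfmd : Differentiable ℝ fm)
    (hfmLip : ∀ x y : EuclideanSpace ℝ (Fin n),
      ‖gradient fm x - gradient fm y‖ ≤ L * ‖x - y‖)
    (hfmw : ∀ x y : EuclideanSpace ℝ (Fin n),
      fm x - fm y - ⟪gradient fm y, x - y⟫ ≥ -(μ / 2) * ‖x - y‖ ^ 2)
    (A : ∀ i : Fin (m - 1), EuclideanSpace ℝ (Fin (d i)) →L[ℝ] EuclideanSpace ℝ (Fin n))
    (b : EuclideanSpace ℝ (Fin n))
    (Abar : ℝ) (hAbar : Abar = ⨆ i, ‖A i‖)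
    -- the full coupling map `𝐀 : E →L Y`, `𝐀x = Σᵢ Aᵢxᵢ`
    (AA : (PiLp 2 fun i : Fin (m - 1) => EuclideanSpace ℝ (Fin (d i))) →L[ℝ]
      EuclideanSpace ℝ (Fin n))
    (hAA : ∀ x, AA x = ∑ i, A i (x i))
    -- optimal solution of the original problem
    (xopt : PiLp 2 fun i : Fin (m - 1) => EuclideanSpace ℝ (Fin (d i)))
    (xmopt : EuclideanSpace ℝ (Fin n))
    (hxoptX : ∀ i, xopt i ∈ Xi i) (hxoptfeas : AA xopt + xmopt = b)
    (hxopt : ∀ (x : PiLp 2 fun i : Fin (m - 1) => EuclideanSpace ℝ (Fin (d i)))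
        (w : EuclideanSpace ℝ (Fin n)), (∀ i, x i ∈ Xi i) → AA x + w = b →
      (∑ i, f i (xopt i)) + fm xmopt ≤ (∑ i, f i (x i)) + fm w)
    -- parameters
    (Lh μbar c α τc ηc : ℝ)
    (hLh : Lh = L + 2 * μ) (hμbar : μbar = 1 / Lh) (hcdef : c = Lh * Abar ^ 2 / μ)
    (hα : α = 1 - 2 / (((m : ℝ) - 1) * (Real.sqrt (1 + 8 * c) + 1)))
    (hτ : τc = α / (1 - α))
    (hη : ηc = (α - ((m : ℝ) - 2) / ((m : ℝ) - 1)) * μ / (1 - α))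
    -- outer sequences of RapDual
    (xbar0 : PiLp 2 fun i : Fin (m - 1) => EuclideanSpace ℝ (Fin (d i)))
    (xmbar0 : EuclideanSpace ℝ (Fin n))
    (hxbar0X : ∀ i, xbar0 i ∈ Xi i) (hfeas0 : AA xbar0 + xmbar0 = b)
    (xbar : (Fin k → Fin s → Fin (m - 1)) → ℕ →
      PiLp 2 fun i : Fin (m - 1) => EuclideanSpace ℝ (Fin (d i)))
    (xmbar : (Fin k → Fin s → Fin (m - 1)) → ℕ → EuclideanSpace ℝ (Fin n))
    (hxbarinit : ∀ ω, xbar ω 0 = xbar0)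
    (hxmbarinit : ∀ ω, xmbar ω 0 = xmbar0)
    -- the dual functions `h^ℓ(y) = (ψ_m^ℓ)^*(−y)` of the subproblems
    (hF : (Fin k → Fin s → Fin (m - 1)) → Fin k →
      EuclideanSpace ℝ (Fin n) → ℝ)
    (hhFdef : ∀ ω ℓ y, hF ω ℓ y =
      ⨆ w : EuclideanSpace ℝ (Fin n),
        (⟪-y, w⟫ - (fm w + μ * ‖w - xmbar ω ℓ.1‖ ^ 2)))
    (hhFd : ∀ ω ℓ, Differentiable ℝ (hF ω ℓ))
    (hhFsc : ∀ ω ℓ y y', hF ω ℓ y - hF ω ℓ y' - ⟪gradient (hF ω ℓ) y', y - y'⟫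
      ≥ (1 / Lh) / 2 * ‖y - y'‖ ^ 2)
    -- inner RaDual iterates for the `ℓ`-th subproblem (`ℓ : Fin k` encodes outer
    -- iteration `ℓ+1`, prox centers `x̄^ℓ = xbar ω ℓ.1`, `x̄_m^ℓ = xmbar ω ℓ.1`)
    (xx : (Fin k → Fin s → Fin (m - 1)) → Fin k → ℕ →
      PiLp 2 fun i : Fin (m - 1) => EuclideanSpace ℝ (Fin (d i)))
    (yy : (Fin k → Fin s → Fin (m - 1)) → Fin k → ℕ → EuclideanSpace ℝ (Fin n))
    (hxx0 : ∀ ω ℓ, xx ω ℓ 0 = xbar ω ℓ.1)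
    (hyy0 : ∀ ω ℓ, yy ω ℓ 0 =
      -gradient (fun w => fm w + μ * ‖w - xmbar ω ℓ.1‖ ^ 2) (xmbar ω ℓ.1))
    -- `yᵗ = argmin_y { h^ℓ(y) + ⟨b − 𝐀x̃ᵗ, y⟩ + τ_t V_{h^ℓ}(y, yᵗ⁻¹) }`,
    -- with `x̃ᵗ = α_t(xᵗ⁻¹ − xᵗ⁻²) + xᵗ⁻¹`, `α_t = (m−1)α`, `x⁻¹ = x⁰`
    (hyymin : ∀ ω (ℓ : Fin k) (t : Fin s), ∀ y : EuclideanSpace ℝ (Fin n),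
      hF ω ℓ (yy ω ℓ (t.1 + 1))
          + ⟪b - AA ((((m : ℝ) - 1) * α) • (xx ω ℓ t.1 - xx ω ℓ (t.1 - 1)) + xx ω ℓ t.1),
              yy ω ℓ (t.1 + 1)⟫
          + τc * breg (hF ω ℓ) (yy ω ℓ (t.1 + 1)) (yy ω ℓ t.1)
        ≤ hF ω ℓ y
          + ⟪b - AA ((((m : ℝ) - 1) * α) • (xx ω ℓ t.1 - xx ω ℓ (t.1 - 1)) + xx ω ℓ t.1), y⟫
          + τc * breg (hF ω ℓ) y (yy ω ℓ t.1))
    -- only the randomly selected block is updated, via the prox-step on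
    -- `ψᵢ^ℓ(z) = fᵢ(z) + μ‖z − x̄ᵢ^{ℓ−1}‖²`
    (hxkeep : ∀ ω (ℓ : Fin k) (t : Fin s) (i : Fin (m - 1)),
      i ≠ ω ℓ t → xx ω ℓ (t.1 + 1) i = xx ω ℓ t.1 i)
    (hxmem : ∀ ω (ℓ : Fin k) (t : Fin s), xx ω ℓ (t.1 + 1) (ω ℓ t) ∈ Xi (ω ℓ t))
    (hxmin : ∀ (ω : Fin k → Fin s → Fin (m - 1)) (ℓ : Fin k) (t : Fin s),
      ∀ z ∈ Xi (ω ℓ t),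
      f (ω ℓ t) (xx ω ℓ (t.1 + 1) (ω ℓ t))
          + μ * ‖xx ω ℓ (t.1 + 1) (ω ℓ t) - xbar ω ℓ.1 (ω ℓ t)‖ ^ 2
          + ⟪ContinuousLinearMap.adjoint (A (ω ℓ t)) (yy ω ℓ (t.1 + 1)),
              xx ω ℓ (t.1 + 1) (ω ℓ t)⟫
          + ηc / 2 * ‖xx ω ℓ (t.1 + 1) (ω ℓ t) - xx ω ℓ t.1 (ω ℓ t)‖ ^ 2
        ≤ f (ω ℓ t) z + μ * ‖z - xbar ω ℓ.1 (ω ℓ t)‖ ^ 2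
          + ⟪ContinuousLinearMap.adjoint (A (ω ℓ t)) (yy ω ℓ (t.1 + 1)), z⟫
          + ηc / 2 * ‖z - xx ω ℓ t.1 (ω ℓ t)‖ ^ 2)
    -- outer updates: `x̄^ℓ = xˢ` and `x̄_m^ℓ = argmin_w {ψ_m^ℓ(w) + ⟨w, yˢ⟩}`
    (hxbarsucc : ∀ ω (ℓ : Fin k), xbar ω (ℓ.1 + 1) = xx ω ℓ s)
    (hxmbarsucc : ∀ ω (ℓ : Fin k), ∀ w : EuclideanSpace ℝ (Fin n),
      fm (xmbar ω (ℓ.1 + 1)) + μ * ‖xmbar ω (ℓ.1 + 1) - xmbar ω ℓ.1‖ ^ 2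
          + ⟪xmbar ω (ℓ.1 + 1), yy ω ℓ s⟫
        ≤ fm w + μ * ‖w - xmbar ω ℓ.1‖ ^ 2 + ⟪w, yy ω ℓ s⟫)
    -- `(x_*^{ℓ+1}, x_{m*}^{ℓ+1})` is the optimal solution of the `ℓ+1`-st subproblem
    (xstar : (Fin k → Fin s → Fin (m - 1)) → Fin k →
      PiLp 2 fun i : Fin (m - 1) => EuclideanSpace ℝ (Fin (d i)))
    (xmstar : (Fin k → Fin s → Fin (m - 1)) → Fin k → EuclideanSpace ℝ (Fin n))
    (hxstarX : ∀ ω ℓ i, xstar ω ℓ i ∈ Xi i)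
    (hxstarfeas : ∀ ω ℓ, AA (xstar ω ℓ) + xmstar ω ℓ = b)
    (hxstaropt : ∀ ω (ℓ : Fin k),
      ∀ (x : PiLp 2 fun i : Fin (m - 1) => EuclideanSpace ℝ (Fin (d i)))
        (w : EuclideanSpace ℝ (Fin n)), (∀ i, x i ∈ Xi i) → AA x + w = b →
      (∑ i, f i (xstar ω ℓ i)) + μ * ‖xstar ω ℓ - xbar ω ℓ.1‖ ^ 2
          + fm (xmstar ω ℓ) + μ * ‖xmstar ω ℓ - xmbar ω ℓ.1‖ ^ 2
        ≤ (∑ i, f i (x i)) + μ * ‖x - xbar ω ℓ.1‖ ^ 2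
          + fm w + μ * ‖w - xmbar ω ℓ.1‖ ^ 2)
    -- the Lagrange multiplier `λ^{ℓ+1} = −∇ψ_m^{ℓ+1}(x_{m*}^{ℓ+1})`
    (lam : (Fin k → Fin s → Fin (m - 1)) → Fin k → EuclideanSpace ℝ (Fin n))
    (hlam : ∀ ω ℓ, lam ω ℓ =
      -gradient (fun w => fm w + μ * ‖w - xmbar ω ℓ.1‖ ^ 2) (xmstar ω ℓ))
    -- condition on the number of inner iterations
    (Mc : ℝ) (hMc : Mc = 4 + 2 * L / μ) (hsM : Mc * α ^ s < 1) :
    -- conclusions of Lemma 6 (the expectation is over `ω` and the uniformly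
    -- chosen `ℓ : Fin k`, encoding `ℓ̂ = ℓ+1`)
    (k : ℝ)⁻¹ * ∑ ℓ : Fin k,
        (Fintype.card (Fin k → Fin s → Fin (m - 1)) : ℝ)⁻¹ *
          ∑ ω : Fin k → Fin s → Fin (m - 1),
            (‖xstar ω ℓ - xbar ω ℓ.1‖ ^ 2 + ‖xmstar ω ℓ - xmbar ω ℓ.1‖ ^ 2)
      ≤ ((∑ i, f i (xbar0 i)) + fm xmbar0 - (∑ i, f i (xopt i)) - fm xmopt) /
          (k * μ * (1 - Mc * α ^ s)) ∧
    (k : ℝ)⁻¹ * ∑ ℓ : Fin k,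
        (Fintype.card (Fin k → Fin s → Fin (m - 1)) : ℝ)⁻¹ *
          ∑ ω : Fin k → Fin s → Fin (m - 1),
            (‖xstar ω ℓ - xbar ω (ℓ.1 + 1)‖ ^ 2 + ‖xmstar ω ℓ - xmbar ω (ℓ.1 + 1)‖ ^ 2)
      ≤ Mc * α ^ s *
          ((∑ i, f i (xbar0 i)) + fm xmbar0 - (∑ i, f i (xopt i)) - fm xmopt) /
          (k * μ * (1 - Mc * α ^ s)) := by
  classical
  have hp1 : (1 : ℝ) ≤ (m : ℝ) - 1 := by
    have : (2 : ℝ) ≤ m := by exact_mod_cast hm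
    linarith
  have hcard : ((m : ℝ) - 1) = Fintype.card (Fin (m - 1)) := by
    rw [Fintype.card_fin, Nat.cast_sub (by omega)]; simp
  have hLhpos : 0 < Lh := by rw [hLh]; linarith
  have hη' : ηc = (α - (((m : ℝ) - 1) - 1) / ((m : ℝ) - 1)) * μ / (1 - α) := by
    rw [hη]; ring
  obtain ⟨hτ0, hα0, hη0, hατ, hητ, hpη⟩ :=
    aux_params ((m : ℝ) - 1) μ Lh Abar c α τc ηc hp1 hμ hLhpos hcdef hα hτ hη'
  have hκ : 0 < (1 / Lh) / 2 := by positivity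
  have hsc : ∀ ω ℓ y y', (1 / Lh) / 2 * ‖y - y'‖ ^ 2 ≤ bregG (hF ω ℓ) y y' :=
    fun ω ℓ y y' => hhFsc ω ℓ y y'
  have hψl := fun c => aux_psi_lower fm hfmd μ c hfmw
  have hψu := fun c => aux_psi_upper fm hfmd μ L c hfmLip
  have hhF : ∀ ω ℓ y, hF ω ℓ y = ⨆ w, (⟪-y, w⟫ - (fun w => fm w + μ * ‖w - xmbar ω ℓ.1‖ ^ 2) w) :=
    hhFdef
  have hopt' : ∀ ω (ℓ : Fin k),
      ∀ (x : PiLp 2 fun i : Fin (m - 1) => EuclideanSpace ℝ (Fin (d i)))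
        (w : EuclideanSpace ℝ (Fin n)), (∀ i, x i ∈ Xi i) → AA x + w = b →
      (∑ i, f i (xstar ω ℓ i)) + μ * ‖xstar ω ℓ - xbar ω ℓ.1‖ ^ 2
          + (fun w => fm w + μ * ‖w - xmbar ω ℓ.1‖ ^ 2) (xmstar ω ℓ)
        ≤ (∑ i, f i (x i)) + μ * ‖x - xbar ω ℓ.1‖ ^ 2
          + (fun w => fm w + μ * ‖w - xmbar ω ℓ.1‖ ^ 2) w := by
    intro ω ℓ x w hx hw
    have := hxstaropt ω ℓ x w hx hw
    simp only
    linarith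
  have hYmin : ∀ ω (ℓ : Fin k) (t : Fin s), ∀ y : EuclideanSpace ℝ (Fin n),
      hF ω ℓ (yy ω ℓ (t.1 + 1))
          + ⟪b - AA ((((m : ℝ) - 1) * α) • (xx ω ℓ t.1 - xx ω ℓ (t.1 - 1)) + xx ω ℓ t.1),
              yy ω ℓ (t.1 + 1)⟫
          + τc * bregG (hF ω ℓ) (yy ω ℓ (t.1 + 1)) (yy ω ℓ t.1)
        ≤ hF ω ℓ y
          + ⟪b - AA ((((m : ℝ) - 1) * α) • (xx ω ℓ t.1 - xx ω ℓ (t.1 - 1)) + xx ω ℓ t.1), y⟫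
          + τc * bregG (hF ω ℓ) y (yy ω ℓ t.1) := hyymin
  -- adaptedness
  have hFeq : ∀ ω ω' (ℓ : Fin k), xmbar ω ℓ.1 = xmbar ω' ℓ.1 → hF ω ℓ = hF ω' ℓ := by
    intro ω ω' ℓ h
    funext y
    rw [hhFdef, hhFdef, h]
  have hYnext : ∀ ω ω' (ℓ : Fin k) (t : Fin s), hF ω ℓ = hF ω' ℓ →
      xx ω ℓ t.1 = xx ω' ℓ t.1 → xx ω ℓ (t.1 - 1) = xx ω' ℓ (t.1 - 1) →
      yy ω ℓ t.1 = yy ω' ℓ t.1 → yy ω ℓ (t.1 + 1) = yy ω' ℓ (t.1 + 1) := by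
    intro ω ω' ℓ t h1 h2 h3 h4
    have e1 := hYmin ω ℓ t
    rw [h1, h2, h3, h4] at e1
    exact aux_y_unique (hF ω' ℓ) (hhFd ω' ℓ) τc _ hτ0 hκ (hsc ω' ℓ) _ _ _ _ (hYmin ω' ℓ t) e1
  have hin : ∀ ω ω' (ℓ : Fin k), xbar ω ℓ.1 = xbar ω' ℓ.1 → xmbar ω ℓ.1 = xmbar ω' ℓ.1 →
      ∀ T, T ≤ s → (∀ t : Fin s, t.1 < T → ω ℓ t = ω' ℓ t) →
      ∀ t, t ≤ T → xx ω ℓ t = xx ω' ℓ t ∧ yy ω ℓ t = yy ω' ℓ t := by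
    intro ω ω' ℓ hxb hxm T
    induction T with
    | zero =>
      intro _ _ t ht
      obtain rfl : t = 0 := by omega
      rw [hxx0, hxx0, hyy0, hyy0, hxb, hxm]
      exact ⟨rfl, rfl⟩
    | succ T ih =>
      intro hT hag t ht
      have ih' := ih (by omega) (fun t ht => hag t (by omega))
      rcases Nat.lt_or_ge t (T + 1) with h | h
      · exact ih' t (by omega)
      obtain rfl : t = T + 1 := by omega
      have hyn := hYnext ω ω' ℓ ⟨T, by omega⟩ (hFeq ω ω' ℓ hxm) (ih' T le_rfl).1
        (ih' (T - 1) (by omega)).1 (ih' T le_rfl).2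
      simp only at hyn
      refine ⟨?_, hyn⟩
      have hi := hag ⟨T, by omega⟩ (by simp)
      have k1 := hxkeep ω ℓ ⟨T, by omega⟩
      have k2 := hxkeep ω' ℓ ⟨T, by omega⟩
      have m1 := hxmem ω ℓ ⟨T, by omega⟩
      have m2 := hxmem ω' ℓ ⟨T, by omega⟩
      have o1 := hxmin ω ℓ ⟨T, by omega⟩
      have o2 := hxmin ω' ℓ ⟨T, by omega⟩
      rw [← hi] at k2 m2 o2
      simp only at k1 k2 m1 m2 o1 o2
      rw [hxb, hyn, (ih' T le_rfl).1] at o1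
      have hu := aux_prox_unique (hXcv _) (f _) μ ηc hμ hη0 (hfw _) _ _ _ m1 m2 o1 o2
      ext1 j
      by_cases hj : j = ω ℓ ⟨T, by omega⟩
      · rw [hj]; exact hu
      · have a1 := k1 j hj
        have a2 := k2 j hj
        rw [(ih' T le_rfl).1] at a1
        exact a1.trans a2.symm
  have hglob : ∀ T, T ≤ k → ∀ ω ω' : Fin k → Fin s → Fin (m - 1),
      (∀ ℓ : Fin k, ℓ.1 < T → ω ℓ = ω' ℓ) → xbar ω T = xbar ω' T ∧ xmbar ω T = xmbar ω' T := by
    intro T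
    induction T with
    | zero =>
      intro _ ω ω' _
      rw [hxbarinit, hxbarinit, hxmbarinit, hxmbarinit]
      exact ⟨rfl, rfl⟩
    | succ T ih =>
      intro hT ω ω' hag
      obtain ⟨i1, i2⟩ := ih (by omega) ω ω' (fun ℓ h => hag ℓ (by omega))
      have hω := hag ⟨T, by omega⟩ (by simp)
      obtain ⟨j1, j2⟩ := hin ω ω' ⟨T, by omega⟩ i1 i2 s le_rfl (fun t _ => by rw [hω]) s le_rfl
      have b1 := hxbarsucc ω ⟨T, by omega⟩
      have b2 := hxbarsucc ω' ⟨T, by omega⟩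
      have o1 := hxmbarsucc ω ⟨T, by omega⟩
      have o2 := hxmbarsucc ω' ⟨T, by omega⟩
      simp only at b1 b2 o1 o2
      refine ⟨by rw [b1, b2, j1], ?_⟩
      rw [i2, j2] at o1
      refine aux_prox_unique (convex_univ) fm μ 0 hμ le_rfl (fun x _ y _ => hfmw x y)
        (xmbar ω' T) 0 (yy ω' ⟨T, by omega⟩ s) (Set.mem_univ _) (Set.mem_univ _) ?_ ?_
      · intro z _
        have := o1 z
        rw [real_inner_comm, real_inner_comm _ z] at this
        linarith
      · intro z _
        have := o2 z
        rw [real_inner_comm, real_inner_comm _ z] at this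
        linarith
  have hstareq : ∀ ω ω' (ℓ : Fin k), xbar ω ℓ.1 = xbar ω' ℓ.1 → xmbar ω ℓ.1 = xmbar ω' ℓ.1 →
      xstar ω ℓ = xstar ω' ℓ ∧ xmstar ω ℓ = xmstar ω' ℓ := by
    intro ω ω' ℓ h1 h2
    have e1 := hopt' ω ℓ
    rw [h1, h2] at e1
    exact aux_opt_unique Xi hXcv μ _ hμ f hfw _ (hψu _) (hψl _) AA b _ _ _ (hxstarX ω' ℓ)
      (hxstarfeas ω' ℓ) (hopt' ω' ℓ) _ _ (hxstarX ω ℓ) (hxstarfeas ω ℓ) e1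
  have hlameq : ∀ ω ω' (ℓ : Fin k), xbar ω ℓ.1 = xbar ω' ℓ.1 → xmbar ω ℓ.1 = xmbar ω' ℓ.1 →
      lam ω ℓ = lam ω' ℓ := by
    intro ω ω' ℓ h1 h2
    rw [hlam, hlam, (hstareq ω ω' ℓ h1 h2).2, h2]
  -- single block differences
  have hAi : ∀ i, ‖A i‖ ≤ Abar := by
    intro i
    rw [hAbar]
    exact le_ciSup (f := fun i => ‖A i‖) (Set.finite_range _).bddAbove i
  have hblk : ∀ ω (ℓ : Fin k) (t : ℕ), t ≤ s →
      ‖AA (xx ω ℓ t - xx ω ℓ (t - 1))‖ ≤ Abar * ‖xx ω ℓ t - xx ω ℓ (t - 1)‖ := by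
    intro ω ℓ t ht
    rcases t with _ | t
    · simp
    have hk1 := hxkeep ω ℓ ⟨t, by omega⟩
    simp only [Nat.add_sub_cancel] at hk1 ⊢
    set i := ω ℓ ⟨t, by omega⟩
    set v := xx ω ℓ (t + 1) - xx ω ℓ t with hv
    have hAv : AA v = A i (v i) := by
      rw [hAA]
      apply Finset.sum_eq_single i
      · intro j _ hj
        have : v j = 0 := by
          show xx ω ℓ (t + 1) j - xx ω ℓ t j = 0
          rw [hk1 j hj, sub_self]
        rw [this, map_zero]
      · simp
    rw [hAv]
    exact ((A i).le_opNorm _).trans (mul_le_mul (hAi i) (PiLp.norm_apply_le v i) (norm_nonneg _)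
      ((norm_nonneg _).trans (hAi i)))
  -- contraction in expectation, one inner step
  set Φ : (Fin k → Fin s → Fin (m - 1)) → Fin k → ℕ → ℝ := fun ω ℓ t =>
    PhiG (hF ω ℓ) (lam ω ℓ) (xstar ω ℓ) AA ((m : ℝ) - 1) τc μ ηc (xx ω ℓ t) (xx ω ℓ (t - 1))
      (yy ω ℓ t) with hΦ
  have hstep : ∀ (ℓ : Fin k) (t : Fin s), ∑ ω, Φ ω ℓ (t.1 + 1) ≤ α * ∑ ω, Φ ω ℓ t.1 := by
    intro ℓ t
    have h1 := aux_avg (fun ω => Φ ω ℓ (t.1 + 1)) ℓ t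
    rw [← hcard] at h1
    have h2 : ∀ ω, ∑ i, Φ (updIdx ω ℓ t i) ℓ (t.1 + 1) ≤ ((m : ℝ) - 1) * (α * Φ ω ℓ t.1) := by
      intro ω
      have a0 : ∀ i, xbar (updIdx ω ℓ t i) ℓ.1 = xbar ω ℓ.1 ∧
          xmbar (updIdx ω ℓ t i) ℓ.1 = xmbar ω ℓ.1 := fun i =>
        hglob ℓ.1 ℓ.2.le _ _ (fun l hl => updIdx_l _ _ _ _ _ (fun h => by
          rw [h] at hl; exact lt_irrefl _ hl))
      have a1 : ∀ i, ∀ t', t' ≤ t.1 → xx (updIdx ω ℓ t i) ℓ t' = xx ω ℓ t' ∧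
          yy (updIdx ω ℓ t i) ℓ t' = yy ω ℓ t' := fun i =>
        hin _ _ ℓ (a0 i).1 (a0 i).2 t.1 t.2.le (fun t' ht' => updIdx_t _ _ _ _ _ (fun h => by
          rw [h] at ht'; exact lt_irrefl _ ht'))
      have a2 : ∀ i, yy (updIdx ω ℓ t i) ℓ (t.1 + 1) = yy ω ℓ (t.1 + 1) := fun i =>
        hYnext _ _ ℓ t (hFeq _ _ ℓ (a0 i).2) (a1 i _ le_rfl).1 (a1 i _ (by omega)).1
          (a1 i _ le_rfl).2
      have a3 : ∀ i, Φ (updIdx ω ℓ t i) ℓ (t.1 + 1) =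
          PhiG (hF ω ℓ) (lam ω ℓ) (xstar ω ℓ) AA ((m : ℝ) - 1) τc μ ηc
            (xx (updIdx ω ℓ t i) ℓ (t.1 + 1)) (xx ω ℓ t.1) (yy ω ℓ (t.1 + 1)) := by
        intro i
        simp only [hΦ, Nat.add_sub_cancel]
        rw [hFeq _ ω ℓ (a0 i).2, hlameq _ ω ℓ (a0 i).1 (a0 i).2,
          (hstareq _ ω ℓ (a0 i).1 (a0 i).2).1, (a1 i _ le_rfl).1, a2]
      simp only [a3]
      have hsad := aux_saddle Xi hXcv μ _ f hfw _ (hψu (xmbar ω ℓ.1)) AA b _ _ _ _ (hxstarX ω ℓ)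
        (hxstarfeas ω ℓ) (hopt' ω ℓ) (hlam ω ℓ)
      refine aux_step Xi hXcv μ f hfw A AA hAA b (xbar ω ℓ.1) (xstar ω ℓ) (xmstar ω ℓ) (lam ω ℓ)
        (hxstarX ω ℓ) (hxstarfeas ω ℓ) ?_ (hF ω ℓ) (hhFd ω ℓ) Lh hLhpos (hsc ω ℓ) ?_
        ((m : ℝ) - 1) τc ηc α Abar hcard hτ0 hα0 hατ hητ hpη (xx ω ℓ t.1) (xx ω ℓ (t.1 - 1))
        (hblk ω ℓ t.1 t.2.le) (yy ω ℓ t.1) (yy ω ℓ (t.1 + 1)) (hYmin ω ℓ t)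
        (fun i => xx (updIdx ω ℓ t i) ℓ (t.1 + 1)) ?_ ?_ ?_
      · intro x hx
        have e1 := hsad x hx
        have e2 : 0 ≤ μ / 2 * ‖x - xstar ω ℓ‖ ^ 2 := by positivity
        linarith
      · exact (aux_conj _ (hF ω ℓ) μ hμ (hψl (xmbar ω ℓ.1)) (hhF ω ℓ) (hhFd ω ℓ) _ _
          (aux_min_of_grad _ μ hμ (hψl _) _ _ (hlam ω ℓ))).2
      · intro i j hj
        have := hxkeep (updIdx ω ℓ t i) ℓ t j (by rw [updIdx_same]; exact hj)
        rw [this, (a1 i _ le_rfl).1]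
      · intro i
        have := hxmem (updIdx ω ℓ t i) ℓ t
        rwa [updIdx_same] at this
      · intro i
        have := hxmin (updIdx ω ℓ t i) ℓ t
        rwa [updIdx_same, (a0 i).1, a2, (a1 i _ le_rfl).1] at this
    have h3 : ((m : ℝ) - 1) * ∑ ω, Φ ω ℓ (t.1 + 1) ≤ ((m : ℝ) - 1) * (α * ∑ ω, Φ ω ℓ t.1) := by
      rw [← h1, Finset.mul_sum, Finset.mul_sum]
      exact Finset.sum_le_sum fun ω _ => h2 ω
    exact le_of_mul_le_mul_left h3 (by linarith)
  have hiter : ∀ (ℓ : Fin k) (t : ℕ), t ≤ s → ∑ ω, Φ ω ℓ t ≤ α ^ t * ∑ ω, Φ ω ℓ 0 := by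
    intro ℓ t
    induction t with
    | zero => intro _; simp
    | succ t ih =>
      intro ht
      refine (hstep ℓ ⟨t, by omega⟩).trans ?_
      rw [pow_succ', mul_assoc]
      exact mul_le_mul_of_nonneg_left (ih (by omega)) hα0
  -- bounds on the potential at both ends
  set a : (Fin k → Fin s → Fin (m - 1)) → Fin k → ℝ := fun ω ℓ =>
    ‖xstar ω ℓ - xbar ω ℓ.1‖ ^ 2 + ‖xmstar ω ℓ - xmbar ω ℓ.1‖ ^ 2 with ha
  set e : (Fin k → Fin s → Fin (m - 1)) → Fin k → ℝ := fun ω ℓ =>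
    ‖xstar ω ℓ - xbar ω (ℓ.1 + 1)‖ ^ 2 + ‖xmstar ω ℓ - xmbar ω (ℓ.1 + 1)‖ ^ 2 with he
  have hlow : ∀ ω ℓ, μ * (1 + τc) / 4 * e ω ℓ ≤ Φ ω ℓ s := by
    intro ω ℓ
    have h1 := aux_breg_conj _ (hF ω ℓ) μ hμ (hψl (xmbar ω ℓ.1)) (hhF ω ℓ) (hhFd ω ℓ) _ _
      (yy ω ℓ s) (xmbar ω (ℓ.1 + 1)) (hlam ω ℓ) (hxmbarsucc ω ℓ)
    have h2 := hψl (xmbar ω ℓ.1) (xmbar ω (ℓ.1 + 1)) (xmstar ω ℓ)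
    have h3 : μ / 2 * ‖xmbar ω (ℓ.1 + 1) - xmstar ω ℓ‖ ^ 2 ≤ bregG (hF ω ℓ) (lam ω ℓ) (yy ω ℓ s) := by
      rw [h1]; exact h2
    have h4 := hsc ω ℓ (lam ω ℓ) (yy ω ℓ s)
    have h5 := aux_cross ((m : ℝ) - 1) (1 + τc) ηc Abar Lh ‖xx ω ℓ s - xx ω ℓ (s - 1)‖
      (by linarith) (by linarith) hLhpos hητ (yy ω ℓ s - lam ω ℓ) _ (hblk ω ℓ s le_rfl)
    have h6 := (abs_le.1 h5).1
    rw [norm_sub_rev (yy ω ℓ s)] at h6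
    simp only [he, hΦ, PhiG]
    rw [hxbarsucc, norm_sub_rev (xstar ω ℓ), norm_sub_rev (xmstar ω ℓ)]
    have h7 : (1 + τc) / (4 * Lh) * ‖lam ω ℓ - yy ω ℓ s‖ ^ 2
        = (1 + τc) / 2 * (1 / Lh / 2 * ‖lam ω ℓ - yy ω ℓ s‖ ^ 2) := by field_simp; ring
    have h8 := mul_le_mul_of_nonneg_left h4 (by linarith : 0 ≤ (1 + τc) / 2)
    have h9 := mul_le_mul_of_nonneg_left h3 (by linarith : 0 ≤ (1 + τc) / 2)
    have h10 : 0 ≤ μ * (1 + τc) / 4 * ‖xx ω ℓ s - xstar ω ℓ‖ ^ 2 := by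
      have : 0 ≤ 1 + τc := by linarith
      positivity
    linarith
  have hup : ∀ ω ℓ, Φ ω ℓ 0 ≤ μ * (1 + τc) / 4 * (Mc * a ω ℓ) := by
    intro ω ℓ
    have h1 := aux_breg_conj _ (hF ω ℓ) μ hμ (hψl (xmbar ω ℓ.1)) (hhF ω ℓ) (hhFd ω ℓ) _ _
      (yy ω ℓ 0) (xmbar ω ℓ.1) (hlam ω ℓ) (aux_min_of_grad _ μ hμ (hψl _) _ _ (hyy0 ω ℓ))
    have h2 := hψu (xmbar ω ℓ.1) (xmbar ω ℓ.1) (xmstar ω ℓ)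
    have h3 : bregG (hF ω ℓ) (lam ω ℓ) (yy ω ℓ 0) ≤
        (L + 2 * μ) / 2 * ‖xmbar ω ℓ.1 - xmstar ω ℓ‖ ^ 2 := by
      rw [h1]; exact h2
    have h4 := mul_le_mul_of_nonneg_left h3 (by linarith : 0 ≤ 1 + τc)
    simp only [ha, hΦ, PhiG]
    rw [hxx0, norm_sub_rev (xstar ω ℓ), norm_sub_rev (xmstar ω ℓ)]
    simp only [Nat.zero_sub, hxx0, sub_self, map_zero, inner_zero_right, norm_zero]
    have h5 : μ * Mc = 4 * μ + 2 * L := by rw [hMc]; field_simp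
    have h6 : 0 ≤ (1 + τc) / 4 * (2 * μ + 2 * L) * ‖xbar ω ℓ.1 - xstar ω ℓ‖ ^ 2 := by
      have : 0 ≤ 1 + τc := by linarith
      have : 0 < L := by linarith
      positivity
    have h7 : μ * (1 + τc) / 4 * (Mc * (‖xbar ω ℓ.1 - xstar ω ℓ‖ ^ 2
        + ‖xmbar ω ℓ.1 - xmstar ω ℓ‖ ^ 2)) = (1 + τc) / 4 * (4 * μ + 2 * L) *
        (‖xbar ω ℓ.1 - xstar ω ℓ‖ ^ 2 + ‖xmbar ω ℓ.1 - xmstar ω ℓ‖ ^ 2) := by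
      rw [← h5]; ring
    rw [h7]
    linarith
  set q := Mc * α ^ s with hq
  have hMc0 : 0 ≤ Mc := by
    rw [hMc]
    have : 0 < L := by linarith
    positivity
  have hq0 : 0 ≤ q := mul_nonneg hMc0 (pow_nonneg hα0 s)
  have hcontr : ∀ ℓ, ∑ ω, e ω ℓ ≤ q * ∑ ω, a ω ℓ := by
    intro ℓ
    have h1 : ∑ ω, μ * (1 + τc) / 4 * e ω ℓ ≤ ∑ ω, Φ ω ℓ s :=
      Finset.sum_le_sum fun ω _ => hlow ω ℓ
    have h2 : ∑ ω, Φ ω ℓ 0 ≤ ∑ ω, μ * (1 + τc) / 4 * (Mc * a ω ℓ) :=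
      Finset.sum_le_sum fun ω _ => hup ω ℓ
    have h3 := hiter ℓ s le_rfl
    have h4 := mul_le_mul_of_nonneg_left h2 (pow_nonneg hα0 s)
    rw [← Finset.mul_sum] at h1
    rw [← Finset.mul_sum, ← Finset.mul_sum] at h4
    have h5 : 0 < μ * (1 + τc) / 4 := by
      have : 0 < 1 + τc := by linarith
      positivity
    refine le_of_mul_le_mul_left ?_ h5
    calc _ ≤ _ := h1
      _ ≤ _ := h3
      _ ≤ _ := h4
      _ = _ := by rw [hq]; ring
  -- outer telescoping
  set D := (∑ i, f i (xbar0 i)) + fm xmbar0 - (∑ i, f i (xopt i)) - fm xmopt with hD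
  have htele : ∀ ω, μ * ∑ ℓ, a ω ℓ ≤ D + μ * ∑ ℓ, e ω ℓ := by
    intro ω
    have h1 := aux_tele' k hk (fun ℓ => (∑ i, f i (xstar ω ℓ i)) + fm (xmstar ω ℓ)) (a ω) (e ω)
      ((∑ i, f i (xbar0 i)) + fm xmbar0) ((∑ i, f i (xopt i)) + fm xmopt) μ hμ.le
      (fun ℓ => by simp only [he]; positivity)
      (fun ℓ => hxopt _ _ (hxstarX ω ℓ) (hxstarfeas ω ℓ))
      (fun ℓ hl => by
        have := hxstaropt ω ℓ xbar0 xmbar0 hxbar0X hfeas0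
        simp only [ha]
        rw [hl] at this ⊢
        rw [hxbarinit, hxmbarinit] at this ⊢
        rw [sub_self, sub_self, norm_zero, norm_zero] at this
        linarith)
      (fun ℓ ℓ' hl => by
        have := hxstaropt ω ℓ' _ _ (hxstarX ω ℓ) (hxstarfeas ω ℓ)
        simp only [ha, he]
        rw [hl] at this ⊢
        linarith)
    rw [hD]
    linarith
  set N : ℝ := (Fintype.card (Fin k → Fin s → Fin (m - 1)) : ℝ) with hN
  have hNpos : 0 < N := by
    have : Nonempty (Fin (m - 1)) := ⟨⟨0, by omega⟩⟩
    rw [hN]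
    exact_mod_cast Fintype.card_pos
  have hkpos : (0 : ℝ) < k := by exact_mod_cast hk
  have hS1 : μ * ∑ ℓ, ∑ ω, a ω ℓ ≤ N * D + μ * ∑ ℓ, ∑ ω, e ω ℓ := by
    rw [Finset.sum_comm, Finset.sum_comm (f := fun ℓ ω => e ω ℓ), Finset.mul_sum, Finset.mul_sum]
    calc _ ≤ ∑ ω, (D + μ * ∑ ℓ, e ω ℓ) := Finset.sum_le_sum fun ω _ => htele ω
      _ = _ := by
        rw [Finset.sum_add_distrib, Finset.sum_const, Finset.card_univ, nsmul_eq_mul]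
  have hS2 : ∑ ℓ, ∑ ω, e ω ℓ ≤ q * ∑ ℓ, ∑ ω, a ω ℓ := by
    rw [Finset.mul_sum]
    exact Finset.sum_le_sum fun ℓ _ => hcontr ℓ
  set Sa := ∑ ℓ, ∑ ω, a ω ℓ with hSa
  set Se := ∑ ℓ, ∑ ω, e ω ℓ with hSe
  have h1q : 0 < 1 - q := by linarith
  have hfin : Sa / (k * N) ≤ D / (k * μ * (1 - q)) := by
    rw [div_le_div_iff₀ (by positivity) (by positivity)]
    have h1 := mul_le_mul_of_nonneg_left hS2 hμ.le
    have h2 : Sa * (μ * (1 - q)) ≤ N * D := by linarith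
    have h3 := mul_le_mul_of_nonneg_left h2 hkpos.le
    linarith
  have hA : (k : ℝ)⁻¹ * ∑ ℓ, N⁻¹ * ∑ ω, a ω ℓ = Sa / (k * N) := by
    rw [← Finset.mul_sum, ← mul_assoc, ← mul_inv, mul_comm, div_eq_mul_inv]
  have hE : (k : ℝ)⁻¹ * ∑ ℓ, N⁻¹ * ∑ ω, e ω ℓ = Se / (k * N) := by
    rw [← Finset.mul_sum, ← mul_assoc, ← mul_inv, mul_comm, div_eq_mul_inv]
  refine ⟨hA.trans_le hfin, hE.trans_le ?_⟩
  calc Se / (k * N) ≤ (q * Sa) / (k * N) := by gcongr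
    _ = q * (Sa / (k * N)) := by ring
    _ ≤ q * (D / (k * μ * (1 - q))) := mul_le_mul_of_nonneg_left hfin hq0
    _ = _ := by ring
end
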